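/- arXiv:1801.07283 — 5 statements merged into one kernel-verified Lean document; each statement's English description precedes it below -/
import Mathlib

section
/- Hidden symmetries of the valency-2 bulk-vertex correction function: let h > 0 be real and Δ, c₀, c₁, s₀, s₁ complex. Call a real number σ admissible for the data (Δ, c₀, c₁, s₀, s₁) if Re s₁ < σ, Re(h−Δ−c₀) < σ, σ < Re(h+c₁), σ < Re(h−c₁) and σ < Re(h−c₀−s₀+s₁); for admissible σ define (with t = σ + i·u) C(Δ,c₀,c₁,s₀,s₁;σ) = (1/2)·(1/(2π)) ∫_ℝ Γ((h+c₁−t)/2)·Γ((h−c₁−t)/2)·Γ((t−s₁)/2)·Γ((Δ−h+c₀+t)/2)·Γ((h−c₀−t−s₀+s₁)/2) / [Γ((h−c₀−s₀)/2)·Γ((h+c₁−s₁)/2)·Γ((h−c₁−s₁)/2)·Γ((Δ+c₀+c₁)/2)·Γ((Δ+c₀−c₁)/2)·Γ((Δ−s₀+s₁)/2)·Γ((Δ+h−c₀−t)/2)] du. Assume that none of (h±c₀−s₀)/2, (h±c₁−s₁)/2, (Δ±c₀±c₁)/2, (Δ−s₀+s₁)/2, (Δ+s₀−s₁)/2 is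 a nonpositive integer. Then: (i) if σ is admissible for (Δ,c₀,c₁,s₀,s₁) and σ′ is admissible for (Δ,−c₀,c₁,s₀,s₁), then C(Δ,c₀,c₁,s₀,s₁;σ) = C(Δ,−c₀,c₁,s₀,s₁;σ′); and (ii) if σ″ is admissible for (Δ,c₁,c₀,s₁,s₀), then C(Δ,c₀,c₁,s₀,s₁;σ) = C(Δ,c₁,c₀,s₁,s₀;σ″). -/
open MeasureTheory

local notation "Γ" => Complex.Gamma

/-- A real number `σ` is admissible for the data `(Δ, c₀, c₁, s₀, s₁)` (at boundary
half-dimension `h`) if the contour `Re t = σ` keeps every numerator Gamma factor of the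
valency-2 vertex correction function at an argument of positive real part. -/
def Admissible (h : ℝ) (Δ c₀ c₁ s₀ s₁ : ℂ) (σ : ℝ) : Prop :=
  s₁.re < σ ∧ ((h : ℂ) - Δ - c₀).re < σ ∧ σ < ((h : ℂ) + c₁).re ∧
    σ < ((h : ℂ) - c₁).re ∧ σ < ((h : ℂ) - c₀ - s₀ + s₁).re

/-- The correction function attached to a bulk vertex of valency 2 in the tree-level
diagrammatic rules (the paper's eq. (3.18)), as a Mellin–Barnes integral along the
upward-oriented vertical contour `Re t = σ`. -/
noncomputable def Cvertex (h : ℝ) (Δ c₀ c₁ s₀ s₁ : ℂ) (σ : ℝ) : ℂ :=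
  (1 / 2) * (1 / (2 * (Real.pi : ℂ))) *
    ∫ u : ℝ,
      let t : ℂ := (σ : ℂ) + (u : ℂ) * Complex.I
      Γ (((h : ℂ) + c₁ - t) / 2) * Γ (((h : ℂ) - c₁ - t) / 2) * Γ ((t - s₁) / 2) *
          Γ ((Δ - (h : ℂ) + c₀ + t) / 2) * Γ (((h : ℂ) - c₀ - t - s₀ + s₁) / 2) /
        (Γ (((h : ℂ) - c₀ - s₀) / 2) * Γ (((h : ℂ) + c₁ - s₁) / 2) *
          Γ (((h : ℂ) - c₁ - s₁) / 2) * Γ ((Δ + c₀ + c₁) / 2) * Γ ((Δ + c₀ - c₁) / 2) *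
          Γ ((Δ - s₀ + s₁) / 2) * Γ ((Δ + (h : ℂ) - c₀ - t) / 2))

lemma vc_norm_Gamma_le {z : ℂ} (hz : 0 < z.re) : ‖Γ z‖ ≤ Real.Gamma z.re := by
  rw [Complex.Gamma_eq_integral hz, Real.Gamma_eq_integral hz, Complex.GammaIntegral]
  refine (norm_integral_le_integral_norm _).trans (le_of_eq ?_)
  refine setIntegral_congr_fun measurableSet_Ioi (fun x hx => ?_)
  have hx' : (0 : ℝ) < x := hx
  simp only [norm_mul, Complex.norm_real, Complex.norm_cpow_eq_rpow_re_of_pos hx',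
    Complex.sub_re, Complex.one_re, Real.norm_eq_abs, Real.abs_exp]

lemma vc_cont {z : ℂ} (hz : 0 < z.re) :
    Continuous (fun u : ℝ => Γ (z + (u : ℂ) * Complex.I)) := by
  rw [continuous_iff_continuousAt]
  intro u
  have h1 : ContinuousAt Γ (z + (u : ℂ) * Complex.I) := by
    refine (Complex.differentiableAt_Gamma _ (fun m hm => ?_)).continuousAt
    have := congrArg Complex.re hm
    simp at this
    have h2 : (0 : ℝ) ≤ m := Nat.cast_nonneg m
    linarith
  exact ContinuousAt.comp (f := fun u : ℝ => z + (u : ℂ) * Complex.I) h1 (by fun_prop)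

lemma vc_bdd {z : ℂ} (hz : 0 < z.re) (u : ℝ) :
    ‖Γ (z + (u : ℂ) * Complex.I)‖ ≤ Real.Gamma z.re := by
  have h : (z + (u : ℂ) * Complex.I).re = z.re := by simp
  have := vc_norm_Gamma_le (z := z + (u : ℂ) * Complex.I) (by rw [h]; exact hz)
  rwa [h] at this

lemma vc_int {z : ℂ} (hz : 0 < z.re) :
    Integrable (fun u : ℝ => Γ (z + (u : ℂ) * Complex.I)) := by
  -- reduce to a real base point
  have key : ∀ x : ℝ, 0 < x → Integrable (fun u : ℝ => Γ ((x : ℂ) + (u : ℂ) * Complex.I)) := by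
    intro x hx
    have hm : 0 < min 1 (x ^ 2) := by positivity
    refine Integrable.mono' (integrable_inv_one_add_sq.const_mul
      (Real.Gamma (x + 2) / min 1 (x ^ 2)))
      (vc_cont (z := (x : ℂ)) (by simpa using hx)).aestronglyMeasurable
      (Filter.Eventually.of_forall (fun u => ?_))
    set w : ℂ := (x : ℂ) + (u : ℂ) * Complex.I with hw
    have hwre : w.re = x := by simp [hw]
    have hwim : w.im = u := by simp [hw]
    have hw0 : w ≠ 0 := fun h => by rw [h] at hwre; simp at hwre; linarith
    have hw1 : w + 1 ≠ 0 := fun h => by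
      have := congrArg Complex.re h
      simp [hwre] at this; linarith
    have e1 : Γ (w + 2) = (w + 1) * (w * Γ w) := by
      rw [← Complex.Gamma_add_one w hw0, ← Complex.Gamma_add_one (w + 1) hw1]
      congr 1; ring
    have b1 : ‖Γ (w + 2)‖ ≤ Real.Gamma (x + 2) := by
      have := vc_norm_Gamma_le (z := w + 2) (by simp [hwre]; linarith)
      simpa [hwre] using this
    have n1 : ‖w‖ ≤ ‖w + 1‖ := by
      rw [← sq_le_sq₀ (norm_nonneg _) (norm_nonneg _), Complex.sq_norm, Complex.sq_norm,
        Complex.normSq_apply, Complex.normSq_apply]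
      simp [hwre, hwim]; nlinarith
    have n2 : min 1 (x ^ 2) * (1 + u ^ 2) ≤ ‖w‖ ^ 2 := by
      rw [Complex.sq_norm, Complex.normSq_apply, hwre, hwim]
      have a1 : min 1 (x ^ 2) ≤ 1 := min_le_left _ _
      have a2 : min 1 (x ^ 2) ≤ x ^ 2 := min_le_right _ _
      nlinarith [sq_nonneg u]
    have n3 : min 1 (x ^ 2) * (1 + u ^ 2) * ‖Γ w‖ ≤ Real.Gamma (x + 2) := by
      refine le_trans ?_ b1
      rw [e1, norm_mul, norm_mul, ← mul_assoc]
      refine mul_le_mul_of_nonneg_right (n2.trans ?_) (norm_nonneg _)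
      rw [sq]
      exact mul_le_mul_of_nonneg_right n1 (norm_nonneg _)
    have hp : 0 < 1 + u ^ 2 := by positivity
    rw [← div_eq_mul_inv, div_div, le_div_iff₀ (by positivity)]
    linarith
  have h2 := (key z.re hz).comp_add_right z.im
  refine h2.congr (Filter.Eventually.of_forall (fun u => ?_))
  simp only
  congr 1
  conv_rhs => rw [← Complex.re_add_im z]
  push_cast
  ring

/-- The minus versions. -/
lemma vc_cont' {z : ℂ} (hz : 0 < z.re) :
    Continuous (fun u : ℝ => Γ (z - (u : ℂ) * Complex.I)) := by
  have := (vc_cont hz).comp continuous_neg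
  refine this.congr (fun u => ?_)
  simp [sub_eq_add_neg]

lemma vc_bdd' {z : ℂ} (hz : 0 < z.re) (u : ℝ) :
    ‖Γ (z - (u : ℂ) * Complex.I)‖ ≤ Real.Gamma z.re := by
  have := vc_bdd hz (-u)
  simpa [sub_eq_add_neg] using this

/-- Beta integral on the half line. -/
lemma vc_beta {p q : ℂ} (hp : 0 < p.re) (hq : 0 < q.re) :
    IntegrableOn (fun x : ℝ => (x : ℂ) ^ (p - 1) * ((1 + x : ℝ) : ℂ) ^ (-(p + q))) (Set.Ioi 0) ∧
    ∫ x in Set.Ioi (0 : ℝ), (x : ℂ) ^ (p - 1) * ((1 + x : ℝ) : ℂ) ^ (-(p + q)) =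
      Γ p * Γ q / Γ (p + q) := by
  let f : ℝ → ℝ := fun x => x / (1 + x)
  let f' : ℝ → ℝ := fun x => 1 / (1 + x) ^ 2
  let g : ℝ → ℂ := fun y => (y : ℂ) ^ (p - 1) * (1 - (y : ℂ)) ^ (q - 1)
  have hder : ∀ x ∈ Set.Ioi (0 : ℝ), HasDerivWithinAt f (f' x) (Set.Ioi 0) x := by
    intro x hx
    have hx' : (0 : ℝ) < x := hx
    have h1 : (1 + x) ≠ 0 := by positivity
    have := ((hasDerivAt_id x).div ((hasDerivAt_id x).const_add 1) h1)
    refine (this.congr_deriv ?_).hasDerivWithinAt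
    simp only [f', id]
    congr 1
    ring
  have hinj : Set.InjOn f (Set.Ioi 0) := by
    intro x hx y hy hxy
    have hx' : (0 : ℝ) < x := hx
    have hy' : (0 : ℝ) < y := hy
    simp only [f] at hxy
    rw [div_eq_div_iff (by positivity) (by positivity)] at hxy
    linarith
  have himg : f '' Set.Ioi 0 = Set.Ioo 0 1 := by
    ext y
    constructor
    · rintro ⟨x, hx, rfl⟩
      have hx' : (0 : ℝ) < x := hx
      refine ⟨by simp only [f]; positivity, ?_⟩
      simp only [f]
      rw [div_lt_one (by positivity)]
      linarith
    · rintro ⟨h0, h1⟩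
      have h2 : 0 < 1 - y := by linarith
      refine ⟨y / (1 - y), by simp only [Set.mem_Ioi]; positivity, ?_⟩
      simp only [f]
      field_simp
      ring
  have hcongr : ∀ x ∈ Set.Ioi (0 : ℝ), |f' x| • g (f x) =
      (x : ℂ) ^ (p - 1) * ((1 + x : ℝ) : ℂ) ^ (-(p + q)) := by
    intro x hx
    have hx' : (0 : ℝ) < x := hx
    have h1 : (0 : ℝ) < 1 + x := by positivity
    have h1c : ((1 + x : ℝ) : ℂ) ≠ 0 := by exact_mod_cast h1.ne'
    have e1 : (1 - ((f x : ℝ) : ℂ)) = (((1 + x)⁻¹ : ℝ) : ℂ) := by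
      rw [← Complex.ofReal_one, ← Complex.ofReal_sub]
      congr 1
      simp only [f]; field_simp; ring
    have e2 : ((f x : ℝ) : ℂ) = (x : ℂ) * (((1 + x)⁻¹ : ℝ) : ℂ) := by
      rw [← Complex.ofReal_mul]; simp only [f, div_eq_mul_inv]
    have e3 : |f' x| = (1 + x)⁻¹ ^ 2 := by
      simp only [f']
      rw [abs_of_pos (by positivity)]; simp
    simp only [g]
    rw [e1, e2, e3, Complex.mul_cpow_ofReal_nonneg hx'.le (by positivity), Complex.real_smul]
    push_cast
    have h1c' : (1 + (x : ℂ)) ≠ 0 := by exact_mod_cast h1.ne'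
    have e4 : ∀ r : ℂ, ((1 + (x : ℂ))⁻¹) ^ r = (1 + (x : ℂ)) ^ (-r) := by
      intro r
      have := Complex.inv_cpow_ofReal_nonneg h1.le r
      push_cast at this
      rw [this, Complex.cpow_neg]
    rw [e4, e4]
    have e5 : (1 + (x : ℂ))⁻¹ ^ 2 = (1 + (x : ℂ)) ^ (-2 : ℂ) := by
      rw [Complex.cpow_neg, inv_pow]; norm_cast
    rw [e5]
    have e6 : (1 + (x : ℂ)) ^ (-(p + q)) =
      (1 + (x : ℂ)) ^ (-2 : ℂ) * (1 + (x : ℂ)) ^ (-(p - 1)) * (1 + (x : ℂ)) ^ (-(q - 1)) := by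
      rw [← Complex.cpow_add _ _ h1c', ← Complex.cpow_add _ _ h1c']
      congr 1; ring
    rw [e6]; ring
  have hgint : IntegrableOn g (Set.Ioo 0 1) := by
    have := Complex.betaIntegral_convergent hp hq
    rwa [intervalIntegrable_iff_integrableOn_Ioo_of_le zero_le_one] at this
  have hgval : ∫ y in Set.Ioo (0 : ℝ) 1, g y = Γ p * Γ q / Γ (p + q) := by
    rw [← Complex.betaIntegral_eq_Gamma_mul_div p q hp hq, Complex.betaIntegral,
      intervalIntegral.integral_of_le zero_le_one, integral_Ioc_eq_integral_Ioo]
  constructor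
  · rw [← himg, integrableOn_image_iff_integrableOn_abs_deriv_smul measurableSet_Ioi hder hinj]
      at hgint
    exact hgint.congr_fun hcongr measurableSet_Ioi
  · rw [← hgval, ← himg, integral_image_eq_integral_abs_deriv_smul measurableSet_Ioi hder hinj]
    exact (setIntegral_congr_fun measurableSet_Ioi hcongr).symm

lemma vc_mellin {a c : ℂ} (ha : 0 < a.re) (hc : 0 < c.re) {s : ℂ} (hs : s.re = 0) :
    MellinConvergent (fun x : ℝ => (x : ℂ) ^ a * ((1 + x : ℝ) : ℂ) ^ (-(a + c))) s ∧
    mellin (fun x : ℝ => (x : ℂ) ^ a * ((1 + x : ℝ) : ℂ) ^ (-(a + c))) s =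
      Γ (a + s) * Γ (c - s) / Γ (a + c) := by
  have hb := vc_beta (p := a + s) (q := c - s) (by simp [hs, ha]) (by simp [hs, hc])
  have e : ∀ x ∈ Set.Ioi (0 : ℝ), (x : ℂ) ^ (a + s - 1) * ((1 + x : ℝ) : ℂ) ^ (-(a + s + (c - s)))
      = (x : ℂ) ^ (s - 1) • ((x : ℂ) ^ a * ((1 + x : ℝ) : ℂ) ^ (-(a + c))) := by
    intro x hx
    have hx' : (0 : ℝ) < x := hx
    have hxc : (x : ℂ) ≠ 0 := by exact_mod_cast hx'.ne'
    rw [smul_eq_mul, ← mul_assoc, ← Complex.cpow_add _ _ hxc]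
    congr 2 <;> ring
  constructor
  · exact hb.1.congr_fun e measurableSet_Ioi
  · rw [mellin, ← setIntegral_congr_fun measurableSet_Ioi e, hb.2]
    congr 2
    ring

lemma vc_int2 {a c : ℂ} (ha : 0 < a.re) (hc : 0 < c.re) :
    Integrable (fun u : ℝ => Γ (a + (u : ℂ) * Complex.I) * Γ (c - (u : ℂ) * Complex.I)) :=
  (vc_int ha).mul_bdd (c := Real.Gamma c.re) (vc_cont' hc).aestronglyMeasurable
    (Filter.Eventually.of_forall (vc_bdd' hc))

lemma vc_inner {a c : ℂ} (ha : 0 < a.re) (hc : 0 < c.re) {x : ℝ} (hx : 0 < x) :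
    ∫ u : ℝ, Γ (a + (u : ℂ) * Complex.I) * Γ (c - (u : ℂ) * Complex.I) *
        Complex.exp ((u : ℂ) * (Real.log x : ℂ) * Complex.I) =
      2 * (Real.pi : ℂ) * Γ (a + c) * ((x : ℂ) ^ c * ((1 + x : ℝ) : ℂ) ^ (-(a + c))) := by
  have hac : Γ (a + c) ≠ 0 := Complex.Gamma_ne_zero_of_re_pos (by simp; linarith)
  have hxi : 0 < x⁻¹ := by positivity
  set f : ℝ → ℂ := fun x : ℝ => (x : ℂ) ^ a * ((1 + x : ℝ) : ℂ) ^ (-(a + c)) with hf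
  have hmel : ∀ y : ℝ, mellin f ((0 : ℝ) + (y : ℂ) * Complex.I) =
      Γ (a + (y : ℂ) * Complex.I) * Γ (c - (y : ℂ) * Complex.I) / Γ (a + c) := by
    intro y
    have := (vc_mellin ha hc (s := ((0 : ℝ) : ℂ) + (y : ℂ) * Complex.I) (by simp)).2
    rw [this]; simp
  have hinv := mellinInv_mellin_eq 0 f hxi
    (vc_mellin ha hc (s := ((0 : ℝ) : ℂ)) (by simp)).1
    (by
      unfold Complex.VerticalIntegrable
      simp_rw [hmel]
      exact (vc_int2 ha hc).div_const _)
    (by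
      have h1 : ((x⁻¹ : ℝ) : ℂ) ∈ Complex.slitPlane := Complex.ofReal_mem_slitPlane.2 hxi
      have h2 : ((1 + x⁻¹ : ℝ) : ℂ) ∈ Complex.slitPlane :=
        Complex.ofReal_mem_slitPlane.2 (by positivity)
      refine ContinuousAt.mul ?_ ?_
      · exact ContinuousAt.cpow (Complex.continuous_ofReal.continuousAt) continuousAt_const h1
      · exact ContinuousAt.cpow (f := fun x : ℝ => ((1 + x : ℝ) : ℂ))
          (by fun_prop) continuousAt_const h2)
  unfold mellinInv at hinv
  simp_rw [hmel] at hinv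
  have e1 : ∀ y : ℝ, ((x⁻¹ : ℝ) : ℂ) ^ (-(((0 : ℝ) : ℂ) + (y : ℂ) * Complex.I)) •
      (Γ (a + (y : ℂ) * Complex.I) * Γ (c - (y : ℂ) * Complex.I) / Γ (a + c)) =
      (Γ (a + (y : ℂ) * Complex.I) * Γ (c - (y : ℂ) * Complex.I) *
        Complex.exp ((y : ℂ) * (Real.log x : ℂ) * Complex.I)) / Γ (a + c) := by
    intro y
    have hne : ((x⁻¹ : ℝ) : ℂ) ≠ 0 := by exact_mod_cast hxi.ne'
    rw [Complex.cpow_def_of_ne_zero hne, ← Complex.ofReal_log hxi.le, Real.log_inv, smul_eq_mul]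
    have : ((-Real.log x : ℝ) : ℂ) * -(((0 : ℝ) : ℂ) + (y : ℂ) * Complex.I) =
      (y : ℂ) * (Real.log x : ℂ) * Complex.I := by push_cast; ring
    rw [this]; ring
  simp_rw [e1] at hinv
  rw [integral_div, Complex.real_smul] at hinv
  have hpi : (Real.pi : ℂ) ≠ 0 := by exact_mod_cast Real.pi_ne_zero
  have e2 : f x⁻¹ = (x : ℂ) ^ c * ((1 + x : ℝ) : ℂ) ^ (-(a + c)) := by
    have hxc : (x : ℂ) ≠ 0 := by exact_mod_cast hx.ne'
    have h3 : (1 + x⁻¹ : ℝ) = (1 + x) * x⁻¹ := by field_simp; ring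
    simp only [hf]
    rw [h3, Complex.ofReal_mul, Complex.mul_cpow_ofReal_nonneg (by positivity) (by positivity),
      Complex.ofReal_inv, Complex.inv_cpow_ofReal_nonneg hx.le, Complex.inv_cpow_ofReal_nonneg hx.le,
      ← Complex.cpow_neg, ← Complex.cpow_neg, mul_comm (((1 + x : ℝ) : ℂ) ^ _), ← mul_assoc,
      ← Complex.cpow_add _ _ hxc]
    congr 2
    ring
  rw [e2] at hinv
  rw [← hinv]
  generalize (∫ u : ℝ, Γ (a + (u : ℂ) * Complex.I) * Γ (c - (u : ℂ) * Complex.I) *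
        Complex.exp ((u : ℂ) * (Real.log x : ℂ) * Complex.I)) = Z
  push_cast
  field_simp

/-- Barnes' first lemma. -/
lemma vc_barnes {a b c d : ℂ} (ha : 0 < a.re) (hb : 0 < b.re) (hc : 0 < c.re) (hd : 0 < d.re) :
    ∫ u : ℝ, Γ (a + (u : ℂ) * Complex.I) * Γ (b + (u : ℂ) * Complex.I) *
        Γ (c - (u : ℂ) * Complex.I) * Γ (d - (u : ℂ) * Complex.I) =
      2 * (Real.pi : ℂ) * (Γ (a + c) * Γ (a + d) * Γ (b + c) * Γ (b + d)) / Γ (a + b + c + d) := by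
  have hbd : Γ (b + d) ≠ 0 := Complex.Gamma_ne_zero_of_re_pos (by simp; linarith)
  let F : ℝ → ℂ := fun u => Γ (a + (u : ℂ) * Complex.I) * Γ (c - (u : ℂ) * Complex.I)
  let H : ℝ → ℂ := fun x => (x : ℂ) ^ (b - 1) * ((1 + x : ℝ) : ℂ) ^ (-(b + d))
  let E : ℝ → ℝ → ℂ := fun u x => Complex.exp ((u : ℂ) * (Real.log x : ℂ) * Complex.I)
  have hF : Integrable F := vc_int2 ha hc
  have hH : Integrable H (volume.restrict (Set.Ioi 0)) := (vc_beta hb hd).1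
  have hprod : Integrable (Function.uncurry fun u x => F u * H x * E u x)
      (volume.prod (volume.restrict (Set.Ioi (0 : ℝ)))) := by
    refine (hF.mul_prod hH).mul_bdd (c := 1) ?_ (Filter.Eventually.of_forall fun z => ?_)
    · refine Measurable.aestronglyMeasurable ?_
      simp only [E]
      have : Measurable fun z : ℝ × ℝ => Real.log z.2 := Real.measurable_log.comp measurable_snd
      fun_prop
    · simp only [E]
      have : ((z.1 : ℂ) * (Real.log z.2 : ℂ) * Complex.I) =
        ((z.1 * Real.log z.2 : ℝ) : ℂ) * Complex.I := by push_cast; ring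
      rw [this, Complex.norm_exp_ofReal_mul_I]
  have e1 : ∀ u : ℝ, ∫ x in Set.Ioi (0 : ℝ), F u * H x * E u x =
      Γ (a + (u : ℂ) * Complex.I) * Γ (b + (u : ℂ) * Complex.I) *
        Γ (c - (u : ℂ) * Complex.I) * Γ (d - (u : ℂ) * Complex.I) / Γ (b + d) := by
    intro u
    have := (vc_beta (p := b + (u : ℂ) * Complex.I) (q := d - (u : ℂ) * Complex.I)
      (by simpa using hb) (by simpa using hd)).2
    have e : ∀ x ∈ Set.Ioi (0 : ℝ), F u * H x * E u x = F u *
      ((x : ℂ) ^ (b + (u : ℂ) * Complex.I - 1) *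
      ((1 + x : ℝ) : ℂ) ^ (-(b + (u : ℂ) * Complex.I + (d - (u : ℂ) * Complex.I)))) := by
      intro x hx
      have hx' : (0 : ℝ) < x := hx
      have hxc : (x : ℂ) ≠ 0 := by exact_mod_cast hx'.ne'
      have h1 : E u x = (x : ℂ) ^ ((u : ℂ) * Complex.I) := by
        rw [Complex.cpow_def_of_ne_zero hxc, ← Complex.ofReal_log hx'.le]
        simp only [E]
        congr 1; ring
      have h2 : (x : ℂ) ^ (b + (u : ℂ) * Complex.I - 1) =
        (x : ℂ) ^ (b - 1) * (x : ℂ) ^ ((u : ℂ) * Complex.I) := by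
        rw [← Complex.cpow_add _ _ hxc]; congr 1; ring
      have h3 : b + (u : ℂ) * Complex.I + (d - (u : ℂ) * Complex.I) = b + d := by ring
      rw [h1, h2, h3]
      simp only [H]; ring
    rw [setIntegral_congr_fun measurableSet_Ioi e, integral_const_mul, this]
    have h3 : b + (u : ℂ) * Complex.I + (d - (u : ℂ) * Complex.I) = b + d := by ring
    rw [h3]
    simp only [F]; ring
  have e2 : ∀ x ∈ Set.Ioi (0 : ℝ), ∫ u : ℝ, F u * H x * E u x =
      2 * (Real.pi : ℂ) * Γ (a + c) *
        ((x : ℂ) ^ (b + c - 1) * ((1 + x : ℝ) : ℂ) ^ (-(b + c + (a + d)))) := by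
    intro x hx
    have hx' : (0 : ℝ) < x := hx
    have hxc : (x : ℂ) ≠ 0 := by exact_mod_cast hx'.ne'
    have hxc1 : ((1 + x : ℝ) : ℂ) ≠ 0 := by
      have : (1 + x : ℝ) ≠ 0 := by positivity
      exact_mod_cast this
    have h0 : ∀ u : ℝ, F u * H x * E u x = H x * (F u * E u x) := fun u => by ring
    simp_rw [h0]
    rw [integral_const_mul]
    have := vc_inner ha hc hx'
    simp only [F, E]
    rw [this]
    have h2 : (x : ℂ) ^ (b + c - 1) = (x : ℂ) ^ (b - 1) * (x : ℂ) ^ c := by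
      rw [← Complex.cpow_add _ _ hxc]; congr 1; ring
    have h3 : ((1 + x : ℝ) : ℂ) ^ (-(b + c + (a + d))) =
        ((1 + x : ℝ) : ℂ) ^ (-(b + d)) * ((1 + x : ℝ) : ℂ) ^ (-(a + c)) := by
      rw [← Complex.cpow_add _ _ hxc1]; congr 1; ring
    rw [h2, h3]
    simp only [H]; ring
  have hswap := integral_integral_swap hprod
  simp_rw [e1] at hswap
  rw [setIntegral_congr_fun measurableSet_Ioi e2, integral_const_mul,
    (vc_beta (p := b + c) (q := a + d) (by simp; linarith) (by simp; linarith)).2,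
    integral_div, div_eq_iff hbd] at hswap
  rw [hswap]
  have h3 : b + c + (a + d) = a + b + c + d := by ring
  rw [h3]; ring

/-- The two-fold Barnes transformation. -/
lemma vc_step {a b g c d e : ℂ} {δ : ℝ} (ha : 0 < a.re) (hb : 0 < b.re) (hg : 0 < g.re)
    (hc : 0 < c.re) (hd : 0 < d.re) (he : 0 < e.re) (hδ : 0 < δ) :
    Γ (a + g) * Γ (b + g) * ∫ u : ℝ, Γ (a + δ + (u : ℂ) * Complex.I) *
        Γ (b + δ + (u : ℂ) * Complex.I) * Γ (c + (u : ℂ) * Complex.I) *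
        Γ (d - (u : ℂ) * Complex.I) * Γ (e - (u : ℂ) * Complex.I) /
        Γ (a + b + g + δ + (u : ℂ) * Complex.I) =
    Γ (c + d) * Γ (c + e) * ∫ v : ℝ, Γ (a + (v : ℂ) * Complex.I) *
        Γ (b + (v : ℂ) * Complex.I) * Γ (g - (v : ℂ) * Complex.I) *
        Γ (d + δ - (v : ℂ) * Complex.I) * Γ (e + δ - (v : ℂ) * Complex.I) /
        Γ (c + d + e + δ - (v : ℂ) * Complex.I) := by
  let P : ℝ → ℂ := fun v => Γ (a + (v : ℂ) * Complex.I) *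
    (Γ (b + (v : ℂ) * Complex.I) * Γ (g - (v : ℂ) * Complex.I))
  let Q : ℝ → ℂ := fun u => Γ (c + (u : ℂ) * Complex.I) *
    (Γ (d - (u : ℂ) * Complex.I) * Γ (e - (u : ℂ) * Complex.I))
  let R : ℝ → ℝ → ℂ := fun u v => Γ ((δ : ℂ) + ((u - v : ℝ) : ℂ) * Complex.I)
  have hδc : 0 < (δ : ℂ).re := by simpa using hδ
  have hP : Integrable P := by
    refine (vc_int ha).mul_bdd (c := Real.Gamma b.re * Real.Gamma g.re)
      ((vc_cont hb).mul (vc_cont' hg)).aestronglyMeasurable (Filter.Eventually.of_forall fun v => ?_)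
    rw [norm_mul]
    exact mul_le_mul (vc_bdd hb v) (vc_bdd' hg v) (norm_nonneg _) (Real.Gamma_pos_of_pos hb).le
  have hQ : Integrable Q := by
    refine (vc_int hc).mul_bdd (c := Real.Gamma d.re * Real.Gamma e.re)
      ((vc_cont' hd).mul (vc_cont' he)).aestronglyMeasurable
      (Filter.Eventually.of_forall fun v => ?_)
    rw [norm_mul]
    exact mul_le_mul (vc_bdd' hd v) (vc_bdd' he v) (norm_nonneg _) (Real.Gamma_pos_of_pos hd).le
  have hprod : Integrable (Function.uncurry fun u v => Q u * P v * R u v)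
      ((volume : Measure ℝ).prod (volume : Measure ℝ)) := by
    refine (hQ.mul_prod hP).mul_bdd (c := Real.Gamma (δ : ℂ).re) ?_
      (Filter.Eventually.of_forall fun z => vc_bdd hδc (z.1 - z.2))
    exact ((vc_cont hδc).comp (continuous_fst.sub continuous_snd)).aestronglyMeasurable
  have e1 : ∀ u : ℝ, ∫ v : ℝ, Q u * P v * R u v = 2 * (Real.pi : ℂ) * (Γ (a + g) * Γ (b + g)) *
      (Γ (a + δ + (u : ℂ) * Complex.I) *
        Γ (b + δ + (u : ℂ) * Complex.I) * Γ (c + (u : ℂ) * Complex.I) *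
        Γ (d - (u : ℂ) * Complex.I) * Γ (e - (u : ℂ) * Complex.I) /
        Γ (a + b + g + δ + (u : ℂ) * Complex.I)) := by
    intro u
    have := vc_barnes (a := a) (b := b) (c := g) (d := δ + (u : ℂ) * Complex.I) ha hb hg
      (by simpa using hδ)
    have h0 : ∀ v : ℝ, Q u * P v * R u v = Q u * (Γ (a + (v : ℂ) * Complex.I) *
        Γ (b + (v : ℂ) * Complex.I) * Γ (g - (v : ℂ) * Complex.I) *
        Γ (δ + (u : ℂ) * Complex.I - (v : ℂ) * Complex.I)) := by
      intro v
      have : (δ : ℂ) + ((u - v : ℝ) : ℂ) * Complex.I =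
        δ + (u : ℂ) * Complex.I - (v : ℂ) * Complex.I := by push_cast; ring
      simp only [P, R]
      rw [this]; ring
    simp_rw [h0]
    rw [integral_const_mul, this]
    simp only [Q, ← add_assoc]
    ring
  have e2 : ∀ v : ℝ, ∫ u : ℝ, Q u * P v * R u v = 2 * (Real.pi : ℂ) * (Γ (c + d) * Γ (c + e)) *
      (Γ (a + (v : ℂ) * Complex.I) *
        Γ (b + (v : ℂ) * Complex.I) * Γ (g - (v : ℂ) * Complex.I) *
        Γ (d + δ - (v : ℂ) * Complex.I) * Γ (e + δ - (v : ℂ) * Complex.I) /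
        Γ (c + d + e + δ - (v : ℂ) * Complex.I)) := by
    intro v
    have := vc_barnes (a := c) (b := δ - (v : ℂ) * Complex.I) (c := d) (d := e) hc
      (by simpa using hδ) hd he
    have h0 : ∀ u : ℝ, Q u * P v * R u v = P v * (Γ (c + (u : ℂ) * Complex.I) *
        Γ (δ - (v : ℂ) * Complex.I + (u : ℂ) * Complex.I) * Γ (d - (u : ℂ) * Complex.I) *
        Γ (e - (u : ℂ) * Complex.I)) := by
      intro u
      have : (δ : ℂ) + ((u - v : ℝ) : ℂ) * Complex.I =
        δ - (v : ℂ) * Complex.I + (u : ℂ) * Complex.I := by push_cast; ring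
      simp only [Q, R]
      rw [this]; ring
    simp_rw [h0]
    rw [integral_const_mul, this]
    have k1 : (δ : ℂ) - (v : ℂ) * Complex.I + d = d + δ - (v : ℂ) * Complex.I := by ring
    have k2 : (δ : ℂ) - (v : ℂ) * Complex.I + e = e + δ - (v : ℂ) * Complex.I := by ring
    have k3 : c + ((δ : ℂ) - (v : ℂ) * Complex.I) + d + e =
      c + d + e + δ - (v : ℂ) * Complex.I := by ring
    rw [k1, k2, k3]
    simp only [P]
    ring
  have hswap := integral_integral_swap hprod
  simp_rw [e1, e2] at hswap
  rw [integral_const_mul, integral_const_mul, mul_assoc, mul_assoc (2 * (Real.pi : ℂ))] at hswap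
  have hpi : (2 * (Real.pi : ℂ)) ≠ 0 := by
    have : (Real.pi : ℂ) ≠ 0 := by exact_mod_cast Real.pi_ne_zero
    simp [this]
  exact mul_left_cancel₀ hpi hswap

/-- The Barnes integral behind the vertex correction. -/
noncomputable def vcJ (a b c d e f : ℂ) (σ : ℝ) : ℂ :=
  ∫ u : ℝ, Γ (a + σ + (u : ℂ) * Complex.I) *
        Γ (b + σ + (u : ℂ) * Complex.I) * Γ (c + σ + (u : ℂ) * Complex.I) *
        Γ (d - σ - (u : ℂ) * Complex.I) * Γ (e - σ - (u : ℂ) * Complex.I) /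
        Γ (f + σ + (u : ℂ) * Complex.I)

/-- The Barnes integral with its symmetric normalization. -/
noncomputable def vcC (a b c d e f : ℂ) (σ : ℝ) : ℂ :=
  vcJ a b c d e f σ /
    (Γ (a + d) * Γ (b + d) * Γ (c + d) * Γ (a + e) * Γ (b + e) * Γ (c + e))

lemma vc_trans {a b c d e f : ℂ} {σ τ : ℝ} (ha : 0 < a.re + τ) (hb : 0 < b.re + τ)
    (hc : 0 < c.re + σ) (hd : σ < d.re) (he : σ < e.re) (hτ : τ < σ)
    (hg : τ < f.re - a.re - b.re) :
    Γ (f - b) * Γ (f - a) * vcJ a b c d e f σ = Γ (c + d) * Γ (c + e) *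
      ∫ v : ℝ, Γ (a + τ + (v : ℂ) * Complex.I) *
        Γ (b + τ + (v : ℂ) * Complex.I) * Γ (f - a - b - τ - (v : ℂ) * Complex.I) *
        Γ (d - τ - (v : ℂ) * Complex.I) * Γ (e - τ - (v : ℂ) * Complex.I) /
        Γ (c + d + e - τ - (v : ℂ) * Complex.I) := by
  have := vc_step (a := a + τ) (b := b + τ) (g := f - a - b - τ) (c := c + σ) (d := d - σ)
    (e := e - σ) (δ := σ - τ) (by simpa using ha) (by simpa using hb)
    (by simp; linarith) (by simpa using hc) (by simpa using hd) (by simpa using he) (by linarith)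
  have k1 : a + τ + (f - a - b - τ) = f - b := by ring
  have k2 : b + τ + (f - a - b - τ) = f - a := by ring
  have k3 : a + τ + ((σ - τ : ℝ) : ℂ) = a + σ := by push_cast; ring
  have k4 : b + τ + ((σ - τ : ℝ) : ℂ) = b + σ := by push_cast; ring
  have k5 : a + τ + (b + τ) + (f - a - b - τ) + ((σ - τ : ℝ) : ℂ) = f + σ := by push_cast; ring
  have k6 : c + σ + (d - σ) = c + d := by ring
  have k7 : c + σ + (e - σ) = c + e := by ring
  have k8 : d - σ + ((σ - τ : ℝ) : ℂ) = d - τ := by push_cast; ring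
  have k9 : e - σ + ((σ - τ : ℝ) : ℂ) = e - τ := by push_cast; ring
  have k10 : c + d + (e - σ) + ((σ - τ : ℝ) : ℂ) = c + d + e - τ := by push_cast; ring
  rw [k1, k2, k3, k4, k5, k6, k7, k8, k9, k10] at this
  exact this

lemma vc_main {a b c d e f c' e' f' : ℂ} {σ σ' : ℝ}
    (hc' : c' = a + b + c + e - f) (he' : e' = f - a - b) (hf' : f' = a + b + e)
    (ha : 0 < a.re + σ) (hb : 0 < b.re + σ) (hc : 0 < c.re + σ) (hd : σ < d.re) (he : σ < e.re)
    (ha2 : 0 < a.re + σ') (hb2 : 0 < b.re + σ') (hc2 : 0 < c'.re + σ') (hd2 : σ' < d.re)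
    (he2 : σ' < e'.re) :
    vcC a b c d e f σ = vcC a b c' d e' f' σ' := by
  obtain ⟨τ, h1, h2⟩ : ∃ τ, max (-a.re) (-b.re) < τ ∧ τ < min σ σ' := by
    apply exists_between
    rw [max_lt_iff, lt_min_iff, lt_min_iff]
    refine ⟨⟨?_, ?_⟩, ?_, ?_⟩ <;> linarith
  rw [max_lt_iff] at h1
  rw [lt_min_iff] at h2
  have her : e'.re = f.re - a.re - b.re := by rw [he']; simp
  have hfr : f'.re = a.re + b.re + e.re := by rw [hf']; simp
  have t1 := vc_trans (a := a) (b := b) (c := c) (d := d) (e := e) (f := f) (σ := σ) (τ := τ)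
    (by linarith) (by linarith) hc hd he h2.1 (by linarith)
  have t2 := vc_trans (a := a) (b := b) (c := c') (d := d) (e := e') (f := f') (σ := σ') (τ := τ)
    (by linarith) (by linarith) hc2 hd2 he2 h2.2 (by linarith)
  have k1 : f' - a - b = e := by rw [hf']; ring
  have k2 : c' + d + e' = c + d + e := by rw [hc', he']; ring
  have k3 : f - a - b = e' := he'.symm
  have k4 : f' - b = a + e := by rw [hf']; ring
  have k5 : f' - a = b + e := by rw [hf']; ring
  have k6 : f - b = a + e' := by rw [he']; ring
  have k7 : f - a = b + e' := by rw [he']; ring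
  have k8 : (∫ v : ℝ, Γ (a + τ + (v : ℂ) * Complex.I) *
        Γ (b + τ + (v : ℂ) * Complex.I) * Γ (e' - τ - (v : ℂ) * Complex.I) *
        Γ (d - τ - (v : ℂ) * Complex.I) * Γ (e - τ - (v : ℂ) * Complex.I) /
        Γ (c + d + e - τ - (v : ℂ) * Complex.I)) = ∫ v : ℝ, Γ (a + τ + (v : ℂ) * Complex.I) *
        Γ (b + τ + (v : ℂ) * Complex.I) * Γ (e - τ - (v : ℂ) * Complex.I) *
        Γ (d - τ - (v : ℂ) * Complex.I) * Γ (e' - τ - (v : ℂ) * Complex.I) /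
        Γ (c + d + e - τ - (v : ℂ) * Complex.I) := by
    congr 1; ext v; ring
  rw [k3, k6, k7, k8] at t1
  rw [k1, k2, k4, k5] at t2
  have g1 : Γ (a + d) ≠ 0 := Complex.Gamma_ne_zero_of_re_pos (by simp; linarith)
  have g2 : Γ (b + d) ≠ 0 := Complex.Gamma_ne_zero_of_re_pos (by simp; linarith)
  have g3 : Γ (c + d) ≠ 0 := Complex.Gamma_ne_zero_of_re_pos (by simp; linarith)
  have g4 : Γ (a + e) ≠ 0 := Complex.Gamma_ne_zero_of_re_pos (by simp; linarith)
  have g5 : Γ (b + e) ≠ 0 := Complex.Gamma_ne_zero_of_re_pos (by simp; linarith)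
  have g6 : Γ (c + e) ≠ 0 := Complex.Gamma_ne_zero_of_re_pos (by simp; linarith)
  have g7 : Γ (c' + d) ≠ 0 := Complex.Gamma_ne_zero_of_re_pos (by simp; linarith)
  have g8 : Γ (a + e') ≠ 0 := Complex.Gamma_ne_zero_of_re_pos (by simp; linarith)
  have g9 : Γ (b + e') ≠ 0 := Complex.Gamma_ne_zero_of_re_pos (by simp; linarith)
  have g10 : Γ (c' + e') ≠ 0 := Complex.Gamma_ne_zero_of_re_pos (by simp; linarith)
  unfold vcC
  revert t1 t2
  generalize vcJ a b c d e f σ = J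
  generalize vcJ a b c' d e' f' σ' = J'
  generalize (∫ v : ℝ, Γ (a + τ + (v : ℂ) * Complex.I) *
        Γ (b + τ + (v : ℂ) * Complex.I) * Γ (e - τ - (v : ℂ) * Complex.I) *
        Γ (d - τ - (v : ℂ) * Complex.I) * Γ (e' - τ - (v : ℂ) * Complex.I) /
        Γ (c + d + e - τ - (v : ℂ) * Complex.I)) = K
  intro t1 t2
  have t1' : J = Γ (c + d) * Γ (c + e) * K / (Γ (a + e') * Γ (b + e')) := by
    rw [eq_div_iff (mul_ne_zero g8 g9)]; linear_combination t1
  have t2' : J' = Γ (c' + d) * Γ (c' + e') * K / (Γ (a + e) * Γ (b + e)) := by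
    rw [eq_div_iff (mul_ne_zero g4 g5)]; linear_combination t2
  rw [t1', t2']
  field_simp

lemma vc_shift (a b c d e f δ : ℂ) (σ : ℝ) :
    vcC (a + δ) (b + δ) (c + δ) (d - δ) (e - δ) (f + δ) σ = vcC a b c d e f (σ + δ.re) := by
  unfold vcC
  congr 1
  · unfold vcJ
    rw [← integral_add_right_eq_self (fun u : ℝ => Γ (a + (σ + δ.re : ℝ) + (u : ℂ) * Complex.I) *
        Γ (b + (σ + δ.re : ℝ) + (u : ℂ) * Complex.I) *
        Γ (c + (σ + δ.re : ℝ) + (u : ℂ) * Complex.I) *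
        Γ (d - (σ + δ.re : ℝ) - (u : ℂ) * Complex.I) *
        Γ (e - (σ + δ.re : ℝ) - (u : ℂ) * Complex.I) /
        Γ (f + (σ + δ.re : ℝ) + (u : ℂ) * Complex.I)) δ.im]
    congr 1
    ext u
    have p : ∀ z : ℂ, z + δ + σ + (u : ℂ) * Complex.I =
        z + (σ + δ.re : ℝ) + ((u + δ.im : ℝ) : ℂ) * Complex.I := by
      intro z
      conv_lhs => rw [← Complex.re_add_im δ]
      push_cast; ring
    have m : ∀ z : ℂ, z - δ - σ - (u : ℂ) * Complex.I =
        z - (σ + δ.re : ℝ) - ((u + δ.im : ℝ) : ℂ) * Complex.I := by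
      intro z
      conv_lhs => rw [← Complex.re_add_im δ]
      push_cast; ring
    rw [p, p, p, p, m, m]
  · have p : ∀ x y : ℂ, x + δ + (y - δ) = x + y := fun x y => by ring
    simp only [p]

lemma vc_rot (a b c d e f : ℂ) (σ : ℝ) : vcC a b c d e f σ = vcC b c a d e f σ := by
  unfold vcC vcJ
  congr 1
  · congr 1; ext u; ring
  · ring

lemma vc_swap (a b c d e f : ℂ) (σ : ℝ) : vcC a b c d e f σ = vcC c b a d e f σ := by
  unfold vcC vcJ
  congr 1
  · congr 1; ext u; ring
  · ring

lemma vc_vertex (h : ℝ) (Δ c₀ c₁ s₀ s₁ : ℂ) (σ : ℝ) :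
    Cvertex h Δ c₀ c₁ s₀ s₁ σ = 1 / (2 * (Real.pi : ℂ)) *
      vcC ((h + c₁) / 2) ((h - c₁) / 2) ((h - c₀ - s₀ + s₁) / 2) (-s₁ / 2) ((Δ - h + c₀) / 2)
        ((Δ + h - c₀) / 2) (-σ / 2) := by
  unfold Cvertex vcC vcJ
  simp only
  rw [← integral_div]
  set g : ℝ → ℂ := fun u => Γ (((h : ℂ) + c₁ - (σ + (u : ℂ) * Complex.I)) / 2) *
          Γ (((h : ℂ) - c₁ - (σ + (u : ℂ) * Complex.I)) / 2) *
          Γ ((σ + (u : ℂ) * Complex.I - s₁) / 2) *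
          Γ ((Δ - (h : ℂ) + c₀ + (σ + (u : ℂ) * Complex.I)) / 2) *
          Γ (((h : ℂ) - c₀ - (σ + (u : ℂ) * Complex.I) - s₀ + s₁) / 2) /
        (Γ (((h : ℂ) - c₀ - s₀) / 2) * Γ (((h : ℂ) + c₁ - s₁) / 2) *
          Γ (((h : ℂ) - c₁ - s₁) / 2) * Γ ((Δ + c₀ + c₁) / 2) * Γ ((Δ + c₀ - c₁) / 2) *
          Γ ((Δ - s₀ + s₁) / 2) * Γ ((Δ + (h : ℂ) - c₀ - (σ + (u : ℂ) * Complex.I)) / 2)) with hg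
  have hs := Measure.integral_comp_mul_left g (-2)
  have habs : |((-2 : ℝ))⁻¹| = 1 / 2 := by rw [abs_inv]; norm_num
  rw [habs, Complex.real_smul] at hs
  have e : ∀ v : ℝ, g (-2 * v) =
      Γ ((h + c₁) / 2 + (-σ / 2 : ℝ) + (v : ℂ) * Complex.I) *
        Γ ((h - c₁) / 2 + (-σ / 2 : ℝ) + (v : ℂ) * Complex.I) *
        Γ ((h - c₀ - s₀ + s₁) / 2 + (-σ / 2 : ℝ) + (v : ℂ) * Complex.I) *
        Γ (-s₁ / 2 - (-σ / 2 : ℝ) - (v : ℂ) * Complex.I) *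
        Γ ((Δ - h + c₀) / 2 - (-σ / 2 : ℝ) - (v : ℂ) * Complex.I) /
        Γ ((Δ + h - c₀) / 2 + (-σ / 2 : ℝ) + (v : ℂ) * Complex.I) /
      (Γ ((h + c₁) / 2 + -s₁ / 2) * Γ ((h - c₁) / 2 + -s₁ / 2) *
        Γ ((h - c₀ - s₀ + s₁) / 2 + -s₁ / 2) * Γ ((h + c₁) / 2 + (Δ - h + c₀) / 2) *
        Γ ((h - c₁) / 2 + (Δ - h + c₀) / 2) *
        Γ ((h - c₀ - s₀ + s₁) / 2 + (Δ - h + c₀) / 2)) := by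
    intro v
    have q1 : ((h : ℂ) + c₁ - (σ + ((-2 * v : ℝ) : ℂ) * Complex.I)) / 2 =
      (h + c₁) / 2 + (-σ / 2 : ℝ) + (v : ℂ) * Complex.I := by push_cast; ring
    have q2 : ((h : ℂ) - c₁ - (σ + ((-2 * v : ℝ) : ℂ) * Complex.I)) / 2 =
      (h - c₁) / 2 + (-σ / 2 : ℝ) + (v : ℂ) * Complex.I := by push_cast; ring
    have q3 : ((σ + ((-2 * v : ℝ) : ℂ) * Complex.I) - s₁) / 2 =
      -s₁ / 2 - (-σ / 2 : ℝ) - (v : ℂ) * Complex.I := by push_cast; ring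
    have q4 : (Δ - (h : ℂ) + c₀ + (σ + ((-2 * v : ℝ) : ℂ) * Complex.I)) / 2 =
      (Δ - h + c₀) / 2 - (-σ / 2 : ℝ) - (v : ℂ) * Complex.I := by push_cast; ring
    have q5 : ((h : ℂ) - c₀ - (σ + ((-2 * v : ℝ) : ℂ) * Complex.I) - s₀ + s₁) / 2 =
      (h - c₀ - s₀ + s₁) / 2 + (-σ / 2 : ℝ) + (v : ℂ) * Complex.I := by push_cast; ring
    have q6 : (Δ + (h : ℂ) - c₀ - (σ + ((-2 * v : ℝ) : ℂ) * Complex.I)) / 2 =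
      (Δ + h - c₀) / 2 + (-σ / 2 : ℝ) + (v : ℂ) * Complex.I := by push_cast; ring
    have r1 : (h + c₁) / 2 + -s₁ / 2 = (h + c₁ - s₁) / 2 := by ring
    have r2 : (h - c₁) / 2 + -s₁ / 2 = (h - c₁ - s₁) / 2 := by ring
    have r3 : (h - c₀ - s₀ + s₁) / 2 + -s₁ / 2 = (h - c₀ - s₀) / 2 := by ring
    have r4 : (h + c₁) / 2 + (Δ - h + c₀) / 2 = (Δ + c₀ + c₁) / 2 := by ring
    have r5 : (h - c₁) / 2 + (Δ - h + c₀) / 2 = (Δ + c₀ - c₁) / 2 := by ring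
    have r6 : (h - c₀ - s₀ + s₁) / 2 + (Δ - h + c₀) / 2 = (Δ - s₀ + s₁) / 2 := by ring
    simp only [hg]
    rw [q1, q2, q3, q4, q5, q6, r1, r2, r3, r4, r5, r6, div_div]
    congr 1 <;> ring
  simp_rw [e] at hs
  rw [hs]
  push_cast
  ring

/-- **Hidden symmetries of the valency-2 bulk-vertex correction function**: `Cvertex` is
invariant under flipping the sign of the spectrum variable `c₀`, and under exchanging the
data `{c₀, s₀} ↔ {c₁, s₁}` of the two attached bulk-to-bulk propagators, each computed
along any admissible contour. -/
theorem vertex_correction_symmetries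
    (h : ℝ) (hh : 0 < h) (Δ c₀ c₁ s₀ s₁ : ℂ)
    (h₁ : ∀ n : ℕ, ((h : ℂ) + c₀ - s₀) / 2 ≠ -(n : ℂ))
    (h₂ : ∀ n : ℕ, ((h : ℂ) - c₀ - s₀) / 2 ≠ -(n : ℂ))
    (h₃ : ∀ n : ℕ, ((h : ℂ) + c₁ - s₁) / 2 ≠ -(n : ℂ))
    (h₄ : ∀ n : ℕ, ((h : ℂ) - c₁ - s₁) / 2 ≠ -(n : ℂ))
    (h₅ : ∀ n : ℕ, (Δ + c₀ + c₁) / 2 ≠ -(n : ℂ))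
    (h₆ : ∀ n : ℕ, (Δ + c₀ - c₁) / 2 ≠ -(n : ℂ))
    (h₇ : ∀ n : ℕ, (Δ - c₀ + c₁) / 2 ≠ -(n : ℂ))
    (h₈ : ∀ n : ℕ, (Δ - c₀ - c₁) / 2 ≠ -(n : ℂ))
    (h₉ : ∀ n : ℕ, (Δ - s₀ + s₁) / 2 ≠ -(n : ℂ))
    (h₁₀ : ∀ n : ℕ, (Δ + s₀ - s₁) / 2 ≠ -(n : ℂ))
    (σ σ' σ'' : ℝ)
    (hσ : Admissible h Δ c₀ c₁ s₀ s₁ σ) :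
    (Admissible h Δ (-c₀) c₁ s₀ s₁ σ' →
        Cvertex h Δ c₀ c₁ s₀ s₁ σ = Cvertex h Δ (-c₀) c₁ s₀ s₁ σ') ∧
    (Admissible h Δ c₁ c₀ s₁ s₀ σ'' →
        Cvertex h Δ c₀ c₁ s₀ s₁ σ = Cvertex h Δ c₁ c₀ s₁ s₀ σ'') := by
  obtain ⟨p1, p2, p3, p4, p5⟩ := hσ
  simp at p1 p2 p3 p4 p5
  constructor
  · rintro ⟨q1, q2, q3, q4, q5⟩
    simp at q1 q2 q3 q4 q5
    rw [vc_vertex, vc_vertex]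
    congr 1
    apply vc_main
    · ring
    · ring
    · ring
    all_goals simp
    all_goals linarith
  · rintro ⟨q1, q2, q3, q4, q5⟩
    simp at q1 q2 q3 q4 q5
    rw [vc_vertex, vc_vertex]
    congr 1
    rw [vc_rot, vc_swap (((h : ℂ) + c₀) / 2)]
    have hs := vc_shift ((h - c₁) / 2) ((h - c₀ - s₀ + s₁) / 2) ((h + c₀ - s₀ + s₁) / 2)
      (-s₁ / 2) ((Δ - h + c₁ + s₀ - s₁) / 2) ((Δ + h - c₁ - s₀ + s₁) / 2) ((s₀ - s₁) / 2)
      (-σ'' / 2)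
    have k1 : ((h : ℂ) - c₁) / 2 + (s₀ - s₁) / 2 = (h - c₁ - s₁ + s₀) / 2 := by ring
    have k2 : ((h : ℂ) - c₀ - s₀ + s₁) / 2 + (s₀ - s₁) / 2 = (h - c₀) / 2 := by ring
    have k3 : ((h : ℂ) + c₀ - s₀ + s₁) / 2 + (s₀ - s₁) / 2 = (h + c₀) / 2 := by ring
    have k4 : -s₁ / 2 - (s₀ - s₁) / 2 = -s₀ / 2 := by ring
    have k5 : (Δ - h + c₁ + s₀ - s₁) / 2 - (s₀ - s₁) / 2 = (Δ - h + c₁) / 2 := by ring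
    have k6 : (Δ + h - c₁ - s₀ + s₁) / 2 + (s₀ - s₁) / 2 = (Δ + h - c₁) / 2 := by ring
    rw [k1, k2, k3, k4, k5, k6] at hs
    rw [hs]
    apply vc_main
    · ring
    · ring
    · ring
    all_goals simp
    all_goals linarith
end

section
/- Equality of the one-fold and two-fold Mellin–Barnes representations of the valency-2 bulk-vertex correction: let h > 0 be real and Δ, c₀, c₁, s₀, s₁ complex, with none of (h±c₀−s₀)/2, (h±c₁−s₁)/2, (Δ±c₀±c₁)/2, (Δ−s₀+s₁)/2 a nonpositive integer. Let σ ∈ ℝ satisfy Re s₁ < σ, Re(h−Δ−c₀) < σ, σ < Re(h+c₁), σ < Re(h−c₁), σ < Re(h−c₀−s₀+s₁), and let ρ₀, ρ₁ ∈ ℝ satisfy, for a = 0,1: ρₐ < 0, ρₐ < −Re cₐ, ρₐ > −Re((h+cₐ−sₐ)/2), together with ρ₀+ρ₁ > −Re((Δ+c₀+c₁)/2). Then, with t = σ + i·u and wₐ = ρₐ + i·vₐ, (1/2)·(1/(2π)) ∫_ℝ Γ((h+c₁−t)/2)·Γ((h−c₁−t)/2)·Γ((t−s₁)/2)·Γ((Δ−h+c₀+t)/2)·Γ((h−c₀−t−s₀+s₁)/2)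 / [Γ((h−c₀−s₀)/2)·Γ((h+c₁−s₁)/2)·Γ((h−c₁−s₁)/2)·Γ((Δ+c₀+c₁)/2)·Γ((Δ+c₀−c₁)/2)·Γ((Δ−s₀+s₁)/2)·Γ((Δ+h−c₀−t)/2)] du = (1/(2π))² ∫_{ℝ²} Γ((Δ+c₀+c₁)/2 + w₀+w₁)·∏_{a=0,1} [Γ(−wₐ)·Γ(−cₐ−wₐ)·Γ((h+cₐ−sₐ)/2 + wₐ)] dv₀ dv₁ / [Γ((Δ+c₀+c₁)/2)·Γ((Δ+c₀−c₁)/2)·Γ((Δ−c₀+c₁)/2)·Γ((Δ−c₀−c₁)/2)·Γ((h+c₀−s₀)/2)·Γ((h−c₀−s₀)/2)·Γ((h+c₁−s₁)/2)·Γ((h−c₁−s₁)/2)]. -/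
open MeasureTheory

local notation "Γ" => Complex.Gamma

namespace VertexAux

open Complex FourierTransform

/-- The Beta density on the real line. -/
noncomputable def phi (a c : ℂ) (y : ℝ) : ℂ :=
  (Real.sigmoid y : ℂ) ^ a * (Real.sigmoid (-y) : ℂ) ^ c

lemma sig_ne (y : ℝ) : (Real.sigmoid y : ℂ) ≠ 0 := by
  exact_mod_cast (Real.sigmoid_pos y).ne'

lemma phi_eq_exp (a c : ℂ) (y : ℝ) :
    phi a c y = cexp ((Real.log (Real.sigmoid y) : ℂ) * a +
      (Real.log (Real.sigmoid (-y)) : ℂ) * c) := by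
  rw [phi, cpow_def_of_ne_zero (sig_ne y), cpow_def_of_ne_zero (sig_ne (-y)), ← Complex.exp_add,
    Complex.ofReal_log (Real.sigmoid_nonneg _), Complex.ofReal_log (Real.sigmoid_nonneg _)]

lemma log_sig (y : ℝ) : Real.log (Real.sigmoid (-y)) = Real.log (Real.sigmoid y) - y := by
  rw [← Real.sigmoid_mul_rexp_neg, Real.log_mul (Real.sigmoid_pos y).ne' (Real.exp_pos _).ne',
    Real.log_exp]
  ring

lemma phi_continuous (a c : ℂ) : Continuous (phi a c) := by
  have : phi a c = fun y : ℝ => cexp ((Real.log (Real.sigmoid y) : ℂ) * a +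
      (Real.log (Real.sigmoid (-y)) : ℂ) * c) := funext (phi_eq_exp a c)
  rw [this]
  have h1 : Continuous fun y : ℝ => Real.log (Real.sigmoid y) :=
    continuous_sigmoid.log fun y => (Real.sigmoid_pos y).ne'
  have h2 : Continuous fun y : ℝ => Real.log (Real.sigmoid (-y)) := h1.comp continuous_neg
  fun_prop

lemma phi_shift (a c : ℂ) (t y : ℝ) :
    cexp (((t * y : ℝ) : ℂ) * I) * phi a c y = phi (a + t * I) (c - t * I) y := by
  rw [phi_eq_exp, phi_eq_exp, ← Complex.exp_add, log_sig]
  congr 1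
  push_cast
  ring

lemma phi_mul_neg (a b c d : ℂ) (y : ℝ) :
    phi a c y * phi b d (-y) = phi (a + d) (b + c) y := by
  rw [phi_eq_exp, phi_eq_exp, phi_eq_exp, ← Complex.exp_add, neg_neg]
  congr 1
  ring

lemma phi_jac (a c : ℂ) (y : ℝ) :
    |Real.sigmoid y * (1 - Real.sigmoid y)| •
      ((Real.sigmoid y : ℂ) ^ (a - 1) * (1 - (Real.sigmoid y : ℂ)) ^ (c - 1)) = phi a c y := by
  have h1 : (1 - (Real.sigmoid y : ℂ)) = (Real.sigmoid (-y) : ℂ) := by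
    rw [Real.sigmoid_neg]; push_cast; rfl
  rw [← Real.sigmoid_neg, abs_of_pos (mul_pos (Real.sigmoid_pos _) (Real.sigmoid_pos _)), h1,
    phi, cpow_sub _ _ (sig_ne y), cpow_sub _ _ (sig_ne (-y)), cpow_one, cpow_one,
    Complex.real_smul]
  have := sig_ne y
  have := sig_ne (-y)
  push_cast
  field_simp

lemma sig_image : Real.sigmoid '' Set.univ = Set.Ioo 0 1 := by
  rw [Set.image_univ, Real.range_sigmoid]

lemma phi_integrable {a c : ℂ} (ha : 0 < a.re) (hc : 0 < c.re) : Integrable (phi a c) := by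
  have h := Complex.betaIntegral_convergent ha hc
  rw [intervalIntegrable_iff_integrableOn_Ioo_of_le zero_le_one, ← sig_image,
    integrableOn_image_iff_integrableOn_abs_deriv_smul MeasurableSet.univ
      (fun x _ => (Real.hasDerivAt_sigmoid x).hasDerivWithinAt)
      Real.sigmoid_injective.injOn, integrableOn_univ] at h
  simpa only [phi_jac] using h

lemma phi_integral {a c : ℂ} (ha : 0 < a.re) (hc : 0 < c.re) :
    ∫ y, phi a c y = Γ a * Γ c / Γ (a + c) := by
  have hne : Γ (a + c) ≠ 0 := Complex.Gamma_ne_zero_of_re_pos (by simp; linarith)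
  rw [eq_div_iff hne, Complex.Gamma_mul_Gamma_eq_betaIntegral ha hc, mul_comm]
  congr 1
  rw [Complex.betaIntegral, intervalIntegral.integral_of_le zero_le_one,
    integral_Ioc_eq_integral_Ioo, ← sig_image,
    integral_image_eq_integral_abs_deriv_smul MeasurableSet.univ
      (fun x _ => (Real.hasDerivAt_sigmoid x).hasDerivWithinAt)
      Real.sigmoid_injective.injOn, setIntegral_univ]
  simp only [phi_jac]

lemma phi_fourier {a c : ℂ} (ha : 0 < a.re) (hc : 0 < c.re) (ξ : ℝ) :
    𝓕 (phi a c) ξ = Γ (a + ((-2 * Real.pi * ξ : ℝ) : ℂ) * I) *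
      Γ (c - ((-2 * Real.pi * ξ : ℝ) : ℂ) * I) / Γ (a + c) := by
  rw [Real.fourier_real_eq_integral_exp_smul]
  have : ∀ v : ℝ, cexp (((-2 * Real.pi * v * ξ : ℝ) : ℂ) * I) • phi a c v =
      phi (a + ((-2 * Real.pi * ξ : ℝ) : ℂ) * I) (c - ((-2 * Real.pi * ξ : ℝ) : ℂ) * I) v := by
    intro v
    rw [← phi_shift, smul_eq_mul]
    congr 4
    ring
  simp only [this]
  rw [phi_integral]
  · congr 2
    ring
  · simpa using ha
  · simpa using hc

/-- Crude bound. -/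
lemma norm_Gamma_le {z : ℂ} (hz : 0 < z.re) : ‖Γ z‖ ≤ Real.Gamma z.re := by
  rw [Complex.Gamma_eq_integral hz, Complex.GammaIntegral, Real.Gamma_eq_integral hz]
  refine (norm_integral_le_integral_norm _).trans (le_of_eq ?_)
  refine setIntegral_congr_fun measurableSet_Ioi fun x hx => ?_
  have hx : 0 < x := hx
  simp only [norm_mul]
  rw [Complex.norm_of_nonneg (Real.exp_pos _).le, Complex.norm_cpow_eq_rpow_re_of_pos hx]
  simp

lemma Gamma_line_continuous {a : ℂ} (ha : 0 < a.re) :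
    Continuous fun t : ℝ => Γ (a + t * I) := by
  rw [continuous_iff_continuousAt]
  intro t
  have h1 : ContinuousAt Γ (a + t * I) := by
    refine (Complex.differentiableAt_Gamma _ fun m h => ?_).continuousAt
    have := congrArg Complex.re h
    simp at this
    have : (0 : ℝ) ≤ m := Nat.cast_nonneg m
    linarith
  have h2 : Continuous fun t : ℝ => a + (t : ℂ) * I := by fun_prop
  exact ContinuousAt.comp (f := fun t : ℝ => a + (t : ℂ) * I) h1 h2.continuousAt

lemma Gamma_line_bound {a : ℂ} (ha : 0 < a.re) (t : ℝ) :
    ‖Γ (a + t * I)‖ ≤ Real.Gamma a.re := by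
  have := norm_Gamma_le (z := a + t * I) (by simpa using ha)
  simpa using this

lemma Gamma_line_integrable {a : ℂ} (ha : 0 < a.re) :
    Integrable fun t : ℝ => Γ (a + t * I) := by
  set m : ℝ := min 1 (a.re ^ 2) with hm
  have hm0 : 0 < m := by positivity
  have hI : Integrable fun t : ℝ => Real.Gamma (a.re + 2) * m⁻¹ * (1 + (t + a.im) ^ 2)⁻¹ :=
    (integrable_inv_one_add_sq.comp_add_right a.im).const_mul _
  refine hI.mono' (Gamma_line_continuous ha).aestronglyMeasurable (Filter.Eventually.of_forall ?_)
  intro t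
  set z : ℂ := a + t * I with hz
  have hzr : z.re = a.re := by simp [hz]
  have hzi : z.im = t + a.im := by simp [hz, add_comm]
  have z0 : z ≠ 0 := fun h => by rw [h] at hzr; simp at hzr; linarith
  have z1 : z + 1 ≠ 0 := fun h => by
    have := congrArg Complex.re h
    simp [hzr] at this; linarith
  have e1 := Complex.Gamma_add_one z z0
  have e2 := Complex.Gamma_add_one (z + 1) z1
  have hb : ‖Γ (z + 1 + 1)‖ ≤ Real.Gamma (a.re + 2) := by
    have := norm_Gamma_le (z := z + 1 + 1) (by simp [hzr]; linarith)
    refine this.trans (le_of_eq ?_)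
    congr 1
    simp [hzr]; ring
  rw [e2, e1, norm_mul, norm_mul] at hb
  have n1 : ‖z‖ ≤ ‖z + 1‖ := by
    rw [← sq_le_sq₀ (norm_nonneg _) (norm_nonneg _), ← Complex.normSq_eq_norm_sq,
      ← Complex.normSq_eq_norm_sq, Complex.normSq_apply, Complex.normSq_apply]
    simp [hzr]
    nlinarith
  have n2 : m * (1 + (t + a.im) ^ 2) ≤ ‖z‖ ^ 2 := by
    rw [← Complex.normSq_eq_norm_sq, Complex.normSq_apply, hzr, hzi]
    have i1 : m ≤ 1 := min_le_left _ _
    have i2 : m ≤ a.re ^ 2 := min_le_right _ _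
    nlinarith [sq_nonneg (t + a.im), mul_nonneg (sub_nonneg.2 i1) (sq_nonneg (t + a.im))]
  have hp : 0 < 1 + (t + a.im) ^ 2 := by positivity
  rw [mul_assoc, ← mul_inv, ← div_eq_mul_inv, le_div_iff₀ (by positivity)]
  calc ‖Γ z‖ * (m * (1 + (t + a.im) ^ 2)) ≤ ‖Γ z‖ * (‖z + 1‖ * ‖z‖) := by
        refine mul_le_mul_of_nonneg_left (n2.trans ?_) (norm_nonneg _)
        rw [sq]
        exact mul_le_mul_of_nonneg_right n1 (norm_nonneg _)
    _ = ‖z + 1‖ * (‖z‖ * ‖Γ z‖) := by ring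
    _ ≤ _ := hb

lemma Gamma_line_neg_continuous {a : ℂ} (ha : 0 < a.re) :
    Continuous fun t : ℝ => Γ (a - t * I) := by
  have := (Gamma_line_continuous ha).comp continuous_neg
  refine this.congr fun t => ?_
  simp [sub_eq_add_neg]

lemma Gamma_line_neg_bound {a : ℂ} (ha : 0 < a.re) (t : ℝ) :
    ‖Γ (a - t * I)‖ ≤ Real.Gamma a.re := by
  have := norm_Gamma_le (z := a - t * I) (by simpa using ha)
  simpa using this

lemma integrable_plus_minus {a c : ℂ} (ha : 0 < a.re) (hc : 0 < c.re) :
    Integrable fun t : ℝ => Γ (a + t * I) * Γ (c - t * I) :=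
  (Gamma_line_integrable ha).mul_bdd (Gamma_line_neg_continuous hc).aestronglyMeasurable
    (Filter.Eventually.of_forall (Gamma_line_neg_bound hc))

lemma phi_fourier_integrable {a c : ℂ} (ha : 0 < a.re) (hc : 0 < c.re) :
    Integrable (𝓕 (phi a c)) := by
  have h := (((integrable_plus_minus ha hc).div_const (Γ (a + c))).comp_mul_left'
    (R := -2 * Real.pi) (by simp [Real.pi_ne_zero]))
  refine h.congr (Filter.Eventually.of_forall fun ξ => ?_)
  rw [phi_fourier ha hc]

/-- The first Barnes lemma on the imaginary axis. -/
lemma barnes_zero {a b c d : ℂ} (ha : 0 < a.re) (hb : 0 < b.re) (hc : 0 < c.re) (hd : 0 < d.re) :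
    ∫ t : ℝ, Γ (a + t * I) * Γ (b + t * I) * Γ (c - t * I) * Γ (d - t * I) =
      2 * Real.pi * (Γ (a + c) * Γ (a + d) * Γ (b + c) * Γ (b + d) / Γ (a + b + c + d)) := by
  have key : ∫ ξ : ℝ, 𝓕 (phi a c) ξ • 𝓕 (phi b d) ξ =
      ∫ y : ℝ, phi a c y • 𝓕 (𝓕 (phi b d)) y := by
    have := VectorFourier.integral_fourierIntegral_smul_eq_flip (L := innerₗ ℝ) (μ := volume)
      (ν := volume) Real.continuous_fourierChar continuous_inner
      (phi_integrable ha hc) (phi_fourier_integrable hb hd)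
    rw [flip_innerₗ] at this
    exact this
  have inv : ∀ y : ℝ, 𝓕 (𝓕 (phi b d)) y = phi b d (-y) := by
    intro y
    have := congrFun ((phi_continuous b d).fourierInv_fourier_eq (phi_integrable hb hd)
      (phi_fourier_integrable hb hd)) (-y)
    rw [← this, Real.fourierInv_eq_fourier_neg, neg_neg]
  simp only [inv, smul_eq_mul, phi_mul_neg] at key
  rw [phi_integral (by simp; linarith) (by simp; linarith)] at key
  have hac : Γ (a + c) ≠ 0 := Complex.Gamma_ne_zero_of_re_pos (by simp; linarith)
  have hbd : Γ (b + d) ≠ 0 := Complex.Gamma_ne_zero_of_re_pos (by simp; linarith)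
  have e : ∀ ξ : ℝ, 𝓕 (phi a c) ξ * 𝓕 (phi b d) ξ =
      (Γ (a + c) * Γ (b + d))⁻¹ * (fun t : ℝ => Γ (a + t * I) * Γ (b + t * I) * Γ (c - t * I) *
        Γ (d - t * I)) ((-2 * Real.pi) * ξ) := by
    intro ξ
    rw [phi_fourier ha hc, phi_fourier hb hd]
    field_simp
  simp only [e] at key
  rw [integral_const_mul, Measure.integral_comp_mul_left (fun t : ℝ => Γ (a + t * I) *
    Γ (b + t * I) * Γ (c - t * I) * Γ (d - t * I))] at key
  have hpi : |(-2 * Real.pi)⁻¹| = (2 * Real.pi)⁻¹ := by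
    rw [abs_inv, abs_mul, abs_neg, abs_two, abs_of_pos Real.pi_pos]
  rw [hpi, Complex.real_smul] at key
  have hpi0 : (Real.pi : ℂ) ≠ 0 := by exact_mod_cast Real.pi_ne_zero
  have hs : a + d + (b + c) = a + b + c + d := by ring
  rw [hs] at key
  have := congrArg (fun z => 2 * (Real.pi : ℂ) * (Γ (a + c) * Γ (b + d)) * z) key
  push_cast at this
  rw [← mul_assoc, ← mul_assoc] at this
  have h1 : 2 * (Real.pi : ℂ) * (Γ (a + c) * Γ (b + d)) * (Γ (a + c) * Γ (b + d))⁻¹ *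
      (2 * (Real.pi : ℂ))⁻¹ = 1 := by
    field_simp
  rw [h1, one_mul] at this
  rw [this]
  ring

lemma integrable_three {α β p : ℂ} (hα : 0 < α.re) (hβ : 0 < β.re) (hp : 0 < p.re) :
    Integrable fun t : ℝ => Γ (α - t * I) * Γ (β - t * I) * Γ (p + t * I) := by
  have h := (integrable_plus_minus hp hα).mul_bdd
    (Gamma_line_neg_continuous hβ).aestronglyMeasurable
    (Filter.Eventually.of_forall (Gamma_line_neg_bound hβ))
  refine h.congr (Filter.Eventually.of_forall fun t => ?_)
  ring

/-- The integrand of the double Mellin–Barnes integral, all contours moved to the imaginary axis. -/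
noncomputable def dbl (X α₀ β₀ p₀ α₁ β₁ p₁ : ℂ) (v : ℝ × ℝ) : ℂ :=
  Γ (X + v.1 * I + v.2 * I) * (Γ (α₀ - v.1 * I) * Γ (β₀ - v.1 * I) * Γ (p₀ + v.1 * I)) *
    (Γ (α₁ - v.2 * I) * Γ (β₁ - v.2 * I) * Γ (p₁ + v.2 * I))

lemma dbl_integrable {X α₀ β₀ p₀ α₁ β₁ p₁ : ℂ} (hX : 0 < X.re) (hα₀ : 0 < α₀.re) (hβ₀ : 0 < β₀.re)
    (hp₀ : 0 < p₀.re) (hα₁ : 0 < α₁.re) (hβ₁ : 0 < β₁.re) (hp₁ : 0 < p₁.re) :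
    Integrable (dbl X α₀ β₀ p₀ α₁ β₁ p₁) (volume.prod volume) := by
  have h := (integrable_three hα₀ hβ₀ hp₀).mul_prod (integrable_three hα₁ hβ₁ hp₁)
  have e : ∀ v : ℝ × ℝ, X + v.1 * I + v.2 * I = X + ((v.1 + v.2 : ℝ) : ℂ) * I := by
    intro v; push_cast; ring
  have hc : Continuous fun v : ℝ × ℝ => Γ (X + v.1 * I + v.2 * I) := by
    simp only [e]
    exact (Gamma_line_continuous hX).comp (continuous_fst.add continuous_snd)
  have hb : ∀ v : ℝ × ℝ, ‖Γ (X + v.1 * I + v.2 * I)‖ ≤ Real.Gamma X.re := by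
    intro v
    rw [e]
    exact Gamma_line_bound hX _
  have h2 := h.bdd_mul hc.aestronglyMeasurable (Filter.Eventually.of_forall hb)
  refine h2.congr (Filter.Eventually.of_forall fun v => ?_)
  simp only [dbl]
  ring

/-- Integrating out the first variable. -/
lemma dbl_inner0 {X α₀ β₀ p₀ α₁ β₁ p₁ : ℂ} (hX : 0 < X.re) (hα₀ : 0 < α₀.re) (hβ₀ : 0 < β₀.re)
    (hp₀ : 0 < p₀.re) (hα₁ : 0 < α₁.re) (hβ₁ : 0 < β₁.re) (hp₁ : 0 < p₁.re) :
    ∫ v : ℝ × ℝ, dbl X α₀ β₀ p₀ α₁ β₁ p₁ v = 2 * Real.pi * (Γ (p₀ + α₀) * Γ (p₀ + β₀)) *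
      ∫ v : ℝ, Γ (α₁ - v * I) * Γ (β₁ - v * I) * (Γ (p₁ + v * I) * Γ (X + α₀ + v * I)) *
        Γ (X + β₀ + v * I) / Γ (X + p₀ + α₀ + β₀ + v * I) := by
  rw [Measure.volume_eq_prod,
    integral_prod_symm _ (dbl_integrable hX hα₀ hβ₀ hp₀ hα₁ hβ₁ hp₁), ← integral_const_mul]
  refine integral_congr_ae (Filter.Eventually.of_forall fun v => ?_)
  have hXv : 0 < (X + v * I).re := by simpa using hX
  have hB := barnes_zero hXv hp₀ hα₀ hβ₀
  have e : ∀ x : ℝ, dbl X α₀ β₀ p₀ α₁ β₁ p₁ (x, v) =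
      (Γ (X + v * I + x * I) * Γ (p₀ + x * I) * Γ (α₀ - x * I) * Γ (β₀ - x * I)) *
      (Γ (α₁ - v * I) * Γ (β₁ - v * I) * Γ (p₁ + v * I)) := by
    intro x
    have : X + x * I + v * I = X + v * I + x * I := by ring
    simp only [dbl, this]
    ring
  simp only [e]
  rw [integral_mul_const, hB, show X + v * I + α₀ = X + α₀ + v * I by ring,
    show X + v * I + β₀ = X + β₀ + v * I by ring,
    show X + v * I + p₀ + α₀ + β₀ = X + p₀ + α₀ + β₀ + v * I by ring]
  ring

/-- Integrating out the second variable. -/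
lemma dbl_inner1 {X α₀ β₀ p₀ α₁ β₁ p₁ : ℂ} (hX : 0 < X.re) (hα₀ : 0 < α₀.re) (hβ₀ : 0 < β₀.re)
    (hp₀ : 0 < p₀.re) (hα₁ : 0 < α₁.re) (hβ₁ : 0 < β₁.re) (hp₁ : 0 < p₁.re) :
    ∫ v : ℝ × ℝ, dbl X α₀ β₀ p₀ α₁ β₁ p₁ v = 2 * Real.pi * (Γ (p₁ + α₁) * Γ (p₁ + β₁)) *
      ∫ v : ℝ, Γ (α₀ - v * I) * Γ (β₀ - v * I) * (Γ (p₀ + v * I) * Γ (X + α₁ + v * I)) *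
        Γ (X + β₁ + v * I) / Γ (X + p₁ + α₁ + β₁ + v * I) := by
  rw [← dbl_inner0 hX hα₁ hβ₁ hp₁ hα₀ hβ₀ hp₀, Measure.volume_eq_prod, ← integral_prod_swap]
  refine integral_congr_ae (Filter.Eventually.of_forall fun v => ?_)
  have : X + v.1 * I + v.2 * I = X + v.2 * I + v.1 * I := by ring
  simp only [dbl, Prod.fst_swap, Prod.snd_swap, this]
  ring

/-- The contour of the second variable may be moved. -/
lemma dbl_shift {X α₀ β₀ p₀ α₁ β₁ p₁ : ℂ} (δ : ℝ) (hX : 0 < X.re) (hα₀ : 0 < α₀.re)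
    (hβ₀ : 0 < β₀.re)
    (hp₀ : 0 < p₀.re) (hα₁ : 0 < α₁.re) (hβ₁ : 0 < β₁.re) (hp₁ : 0 < p₁.re)
    (hδ : 0 ≤ δ) (hα₁' : δ < α₁.re) (hβ₁' : δ < β₁.re) :
    ∫ v : ℝ × ℝ, dbl X α₀ β₀ p₀ α₁ β₁ p₁ v =
      ∫ v : ℝ × ℝ, dbl (X + δ) α₀ β₀ p₀ (α₁ - δ) (β₁ - δ) (p₁ + δ) v := by
  rw [dbl_inner1 hX hα₀ hβ₀ hp₀ hα₁ hβ₁ hp₁, dbl_inner1 (X := X + δ) (by simp; linarith) hα₀ hβ₀ hp₀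
    (by simpa using hα₁') (by simpa using hβ₁') (by simp; linarith),
    show p₁ + δ + (α₁ - δ) = p₁ + α₁ by ring, show p₁ + δ + (β₁ - δ) = p₁ + β₁ by ring,
    show X + δ + (α₁ - δ) = X + α₁ by ring, show X + δ + (β₁ - δ) = X + β₁ by ring,
    show X + δ + (p₁ + δ) + (α₁ - δ) + (β₁ - δ) = X + p₁ + α₁ + β₁ by ring]

/-- Two-fold integral as a transformed one-fold integral. -/
lemma dbl_transform {X α₀ β₀ p₀ α₁ β₁ p₁ Y : ℂ} (hX : 0 < X.re) (hα₀ : 0 < α₀.re)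
    (hβ₀ : 0 < β₀.re)
    (hp₀ : 0 < p₀.re) (hα₁ : 0 < α₁.re) (hβ₁ : 0 < β₁.re) (hp₁ : 0 < p₁.re)
    (hY : 0 < Y.re) (h1 : 0 < (X + α₀ - Y).re) (h2 : 0 < (p₁ - Y).re)
    (h3 : 0 < (p₀ + β₀ - p₁ + Y).re) :
    (∫ v : ℝ × ℝ, dbl X α₀ β₀ p₀ α₁ β₁ p₁ v) * Γ (X + p₀ + α₀ + β₀ - p₁) =
      Γ (p₀ + α₀) * (2 * Real.pi * (Γ (X + β₀ + α₁) * Γ (X + β₀ + β₁))) *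
      ∫ v : ℝ, Γ (X + α₀ - Y - v * I) * Γ (p₁ - Y - v * I) *
        (Γ (p₀ + β₀ - p₁ + Y + v * I) * Γ (Y + α₁ + v * I)) *
        Γ (Y + β₁ + v * I) / Γ (Y + (X + β₀) + α₁ + β₁ + v * I) := by
  have h4 : 0 < (X + β₀).re := by simp; linarith
  have hE0 := dbl_inner0 hY h1 h2 h3 hα₁ hβ₁ h4
  have hE1 := dbl_inner1 hY h1 h2 h3 hα₁ hβ₁ h4
  have hne : Γ (p₀ + β₀) ≠ 0 := Complex.Gamma_ne_zero_of_re_pos (by simp; linarith)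
  rw [dbl_inner0 hX hα₀ hβ₀ hp₀ hα₁ hβ₁ hp₁]
  rw [mul_assoc (Γ (p₀ + α₀)), ← hE1, hE0,
    show p₀ + β₀ - p₁ + Y + (X + α₀ - Y) = X + p₀ + α₀ + β₀ - p₁ by ring,
    show p₀ + β₀ - p₁ + Y + (p₁ - Y) = p₀ + β₀ by ring,
    show Y + (X + α₀ - Y) = X + α₀ by ring, show Y + (p₁ - Y) = p₁ by ring,
    show Y + (p₀ + β₀ - p₁ + Y) + (X + α₀ - Y) + (p₁ - Y) = X + p₀ + α₀ + β₀ by ring]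
  have : ∀ v : ℝ, Γ (X + β₀ + v * I) * Γ (X + α₀ + v * I) * Γ (p₁ + v * I) =
      Γ (p₁ + v * I) * Γ (X + α₀ + v * I) * Γ (X + β₀ + v * I) := fun v => by ring
  simp only [mul_assoc] at this ⊢
  simp only [this]
  ring

end VertexAux

/-- Equality of the one-fold and two-fold Mellin–Barnes representations of the valency-2
bulk-vertex correction function: the left-hand side is the paper's one-dimensional
representation (3.18), and the right-hand side is the `r = 2` case of its general
representation (3.24).  Here `t = σ + i u` and `wₐ = ρₐ + i vₐ` run along upward-oriented
vertical contours. -/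
theorem vertex_correction_two_representations
    (h : ℝ) (hh : 0 < h) (Δ c₀ c₁ s₀ s₁ : ℂ)
    (h₁ : ∀ n : ℕ, ((h : ℂ) + c₀ - s₀) / 2 ≠ -(n : ℂ))
    (h₂ : ∀ n : ℕ, ((h : ℂ) - c₀ - s₀) / 2 ≠ -(n : ℂ))
    (h₃ : ∀ n : ℕ, ((h : ℂ) + c₁ - s₁) / 2 ≠ -(n : ℂ))
    (h₄ : ∀ n : ℕ, ((h : ℂ) - c₁ - s₁) / 2 ≠ -(n : ℂ))
    (h₅ : ∀ n : ℕ, (Δ + c₀ + c₁) / 2 ≠ -(n : ℂ))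
    (h₆ : ∀ n : ℕ, (Δ + c₀ - c₁) / 2 ≠ -(n : ℂ))
    (h₇ : ∀ n : ℕ, (Δ - c₀ + c₁) / 2 ≠ -(n : ℂ))
    (h₈ : ∀ n : ℕ, (Δ - c₀ - c₁) / 2 ≠ -(n : ℂ))
    (h₉ : ∀ n : ℕ, (Δ - s₀ + s₁) / 2 ≠ -(n : ℂ))
    (σ : ℝ)
    (hσ₁ : s₁.re < σ) (hσ₂ : ((h : ℂ) - Δ - c₀).re < σ)
    (hσ₃ : σ < ((h : ℂ) + c₁).re) (hσ₄ : σ < ((h : ℂ) - c₁).re)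
    (hσ₅ : σ < ((h : ℂ) - c₀ - s₀ + s₁).re)
    (ρ₀ ρ₁ : ℝ)
    (hρ₀₁ : ρ₀ < 0) (hρ₀₂ : ρ₀ < -c₀.re) (hρ₀₃ : -(((h : ℂ) + c₀ - s₀) / 2).re < ρ₀)
    (hρ₁₁ : ρ₁ < 0) (hρ₁₂ : ρ₁ < -c₁.re) (hρ₁₃ : -(((h : ℂ) + c₁ - s₁) / 2).re < ρ₁)
    (hρ : -((Δ + c₀ + c₁) / 2).re < ρ₀ + ρ₁) :
    (1 / 2) * (1 / (2 * (Real.pi : ℂ))) *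
      (∫ u : ℝ,
        let t : ℂ := (σ : ℂ) + (u : ℂ) * Complex.I
        Γ (((h : ℂ) + c₁ - t) / 2) * Γ (((h : ℂ) - c₁ - t) / 2) * Γ ((t - s₁) / 2) *
            Γ ((Δ - (h : ℂ) + c₀ + t) / 2) * Γ (((h : ℂ) - c₀ - t - s₀ + s₁) / 2) /
          (Γ (((h : ℂ) - c₀ - s₀) / 2) * Γ (((h : ℂ) + c₁ - s₁) / 2) *
            Γ (((h : ℂ) - c₁ - s₁) / 2) * Γ ((Δ + c₀ + c₁) / 2) * Γ ((Δ + c₀ - c₁) / 2) *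
            Γ ((Δ - s₀ + s₁) / 2) * Γ ((Δ + (h : ℂ) - c₀ - t) / 2))) =
      ((1 / (2 * (Real.pi : ℂ))) ^ 2 *
        ∫ v : ℝ × ℝ,
          let w₀ : ℂ := (ρ₀ : ℂ) + (v.1 : ℂ) * Complex.I
          let w₁ : ℂ := (ρ₁ : ℂ) + (v.2 : ℂ) * Complex.I
          Γ ((Δ + c₀ + c₁) / 2 + w₀ + w₁) *
            (Γ (-w₀) * Γ (-c₀ - w₀) * Γ (((h : ℂ) + c₀ - s₀) / 2 + w₀)) *
            (Γ (-w₁) * Γ (-c₁ - w₁) * Γ (((h : ℂ) + c₁ - s₁) / 2 + w₁))) /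
      (Γ ((Δ + c₀ + c₁) / 2) * Γ ((Δ + c₀ - c₁) / 2) * Γ ((Δ - c₀ + c₁) / 2) *
        Γ ((Δ - c₀ - c₁) / 2) * Γ (((h : ℂ) + c₀ - s₀) / 2) * Γ (((h : ℂ) - c₀ - s₀) / 2) *
        Γ (((h : ℂ) + c₁ - s₁) / 2) * Γ (((h : ℂ) - c₁ - s₁) / 2)) := by
  simp only [Complex.sub_re, Complex.add_re, Complex.ofReal_re, Complex.div_ofNat_re]
    at hσ₂ hσ₃ hσ₄ hσ₅ hρ₀₃ hρ₁₃ hρ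
  -- a suitable shift of the second contour
  obtain ⟨δ, hδ0, hδ1, hδ2, hδ3⟩ : ∃ δ : ℝ, 0 ≤ δ ∧ δ < -ρ₁ ∧ δ < -c₁.re - ρ₁ ∧
      -(h + c₁.re - σ) / 2 < ρ₁ + δ := by
    have hlt : max ρ₁ (-(h + c₁.re - σ) / 2) < min 0 (-c₁.re) := by
      refine max_lt (lt_min hρ₁₁ hρ₁₂) (lt_min ?_ ?_) <;> linarith
    obtain ⟨x, hx1, hx2⟩ := exists_between hlt
    rw [max_lt_iff] at hx1
    rw [lt_min_iff] at hx2
    exact ⟨x - ρ₁, by linarith, by linarith, by linarith, by linarith⟩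
  -- the double integral
  have hdbl : (∫ v : ℝ × ℝ,
          let w₀ : ℂ := (ρ₀ : ℂ) + (v.1 : ℂ) * Complex.I
          let w₁ : ℂ := (ρ₁ : ℂ) + (v.2 : ℂ) * Complex.I
          Γ ((Δ + c₀ + c₁) / 2 + w₀ + w₁) *
            (Γ (-w₀) * Γ (-c₀ - w₀) * Γ (((h : ℂ) + c₀ - s₀) / 2 + w₀)) *
            (Γ (-w₁) * Γ (-c₁ - w₁) * Γ (((h : ℂ) + c₁ - s₁) / 2 + w₁))) =
      ∫ v : ℝ × ℝ, VertexAux.dbl ((Δ + c₀ + c₁) / 2 + ρ₀ + ρ₁) (-ρ₀) (-c₀ - ρ₀)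
        (((h : ℂ) + c₀ - s₀) / 2 + ρ₀) (-ρ₁) (-c₁ - ρ₁) (((h : ℂ) + c₁ - s₁) / 2 + ρ₁) v := by
    refine integral_congr_ae (Filter.Eventually.of_forall fun v => ?_)
    simp only [VertexAux.dbl]
    congr 1
    · congr 1
      · congr 1; ring
      · congr 1
        · congr 2 <;> ring
        · congr 1; ring
    · congr 1
      · congr 2 <;> ring
      · congr 1; ring
  rw [hdbl, VertexAux.dbl_shift δ (by simp; linarith) (by simp; linarith) (by simp; linarith)
    (by simp; linarith) (by simp; linarith) (by simp; linarith) (by simp; linarith) hδ0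
    (by simpa using hδ1) (by simpa using hδ2)]
  have key := VertexAux.dbl_transform (X := (Δ + c₀ + c₁) / 2 + ρ₀ + ρ₁ + δ) (α₀ := -ρ₀)
    (β₀ := -c₀ - ρ₀) (p₀ := ((h : ℂ) + c₀ - s₀) / 2 + ρ₀) (α₁ := -ρ₁ - δ) (β₁ := -c₁ - ρ₁ - δ)
    (p₁ := ((h : ℂ) + c₁ - s₁) / 2 + ρ₁ + δ) (Y := ρ₁ + δ + (h + c₁ - σ) / 2)
    (by simp; linarith) (by simp; linarith) (by simp; linarith)
    (by simp; linarith) (by simp; linarith) (by simp; linarith) (by simp; linarith)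
    (by simp; linarith) (by simp; linarith) (by simp; linarith) (by simp; linarith)
  set D : ℂ := ∫ v : ℝ × ℝ, VertexAux.dbl ((Δ + c₀ + c₁) / 2 + ρ₀ + ρ₁ + δ) (-ρ₀) (-c₀ - ρ₀)
        (((h : ℂ) + c₀ - s₀) / 2 + ρ₀) (-ρ₁ - δ) (-c₁ - ρ₁ - δ)
        (((h : ℂ) + c₁ - s₁) / 2 + ρ₁ + δ) v with hD
  rw [show (Δ + c₀ + c₁) / 2 + ρ₀ + ρ₁ + δ + (((h : ℂ) + c₀ - s₀) / 2 + ρ₀) + -ρ₀ + (-c₀ - ρ₀) -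
      (((h : ℂ) + c₁ - s₁) / 2 + ρ₁ + δ) = (Δ - s₀ + s₁) / 2 by ring,
    show ((h : ℂ) + c₀ - s₀) / 2 + ρ₀ + -ρ₀ = ((h : ℂ) + c₀ - s₀) / 2 by ring,
    show (Δ + c₀ + c₁) / 2 + ρ₀ + ρ₁ + δ + (-c₀ - ρ₀) + (-ρ₁ - δ) = (Δ - c₀ + c₁) / 2 by ring,
    show (Δ + c₀ + c₁) / 2 + ρ₀ + ρ₁ + δ + (-c₀ - ρ₀) + (-c₁ - ρ₁ - δ) = (Δ - c₀ - c₁) / 2 by ring]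
    at key
  set g : ℝ → ℂ := fun v => Γ ((Δ + c₀ + c₁) / 2 + ρ₀ + ρ₁ + δ + -ρ₀ -
      (ρ₁ + δ + (h + c₁ - σ) / 2) - v * Complex.I) *
      Γ (((h : ℂ) + c₁ - s₁) / 2 + ρ₁ + δ - (ρ₁ + δ + (h + c₁ - σ) / 2) - v * Complex.I) *
        (Γ (((h : ℂ) + c₀ - s₀) / 2 + ρ₀ + (-c₀ - ρ₀) - (((h : ℂ) + c₁ - s₁) / 2 + ρ₁ + δ) +
          (ρ₁ + δ + (h + c₁ - σ) / 2) + v * Complex.I) *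
        Γ (ρ₁ + δ + (h + c₁ - σ) / 2 + (-ρ₁ - δ) + v * Complex.I)) *
        Γ (ρ₁ + δ + (h + c₁ - σ) / 2 + (-c₁ - ρ₁ - δ) + v * Complex.I) /
        Γ (ρ₁ + δ + (h + c₁ - σ) / 2 + ((Δ + c₀ + c₁) / 2 + ρ₀ + ρ₁ + δ + (-c₀ - ρ₀)) +
          (-ρ₁ - δ) + (-c₁ - ρ₁ - δ) + v * Complex.I) with hg
  have hL : (∫ u : ℝ,
        let t : ℂ := (σ : ℂ) + (u : ℂ) * Complex.I
        Γ (((h : ℂ) + c₁ - t) / 2) * Γ (((h : ℂ) - c₁ - t) / 2) * Γ ((t - s₁) / 2) *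
            Γ ((Δ - (h : ℂ) + c₀ + t) / 2) * Γ (((h : ℂ) - c₀ - t - s₀ + s₁) / 2) /
          (Γ (((h : ℂ) - c₀ - s₀) / 2) * Γ (((h : ℂ) + c₁ - s₁) / 2) *
            Γ (((h : ℂ) - c₁ - s₁) / 2) * Γ ((Δ + c₀ + c₁) / 2) * Γ ((Δ + c₀ - c₁) / 2) *
            Γ ((Δ - s₀ + s₁) / 2) * Γ ((Δ + (h : ℂ) - c₀ - t) / 2))) =
      2 * (Γ (((h : ℂ) - c₀ - s₀) / 2) * Γ (((h : ℂ) + c₁ - s₁) / 2) *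
            Γ (((h : ℂ) - c₁ - s₁) / 2) * Γ ((Δ + c₀ + c₁) / 2) * Γ ((Δ + c₀ - c₁) / 2) *
            Γ ((Δ - s₀ + s₁) / 2))⁻¹ * ∫ v : ℝ, g v := by
    have hsub := Measure.integral_comp_mul_left g (-1 / 2)
    have h2 : |((-1 / 2 : ℝ))⁻¹| = 2 := by norm_num
    rw [h2, Complex.real_smul] at hsub
    push_cast at hsub
    rw [mul_comm (2 : ℂ) (_)⁻¹, mul_assoc _ (2 : ℂ), ← hsub, ← integral_const_mul]
    refine integral_congr_ae (Filter.Eventually.of_forall fun u => ?_)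
    simp only [hg]
    rw [show (Δ + c₀ + c₁) / 2 + ρ₀ + ρ₁ + δ + -ρ₀ - (ρ₁ + δ + (h + c₁ - σ) / 2) -
          ((-1 / 2 * u : ℝ) : ℂ) * Complex.I =
            (Δ - (h : ℂ) + c₀ + ((σ : ℂ) + (u : ℂ) * Complex.I)) / 2 by push_cast; ring,
      show ((h : ℂ) + c₁ - s₁) / 2 + ρ₁ + δ - (ρ₁ + δ + (h + c₁ - σ) / 2) -
          ((-1 / 2 * u : ℝ) : ℂ) * Complex.I =
            ((σ : ℂ) + (u : ℂ) * Complex.I - s₁) / 2 by push_cast; ring,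
      show ((h : ℂ) + c₀ - s₀) / 2 + ρ₀ + (-c₀ - ρ₀) - (((h : ℂ) + c₁ - s₁) / 2 + ρ₁ + δ) +
          (ρ₁ + δ + (h + c₁ - σ) / 2) + ((-1 / 2 * u : ℝ) : ℂ) * Complex.I =
            ((h : ℂ) - c₀ - ((σ : ℂ) + (u : ℂ) * Complex.I) - s₀ + s₁) / 2 by push_cast; ring,
      show ρ₁ + δ + (h + c₁ - σ) / 2 + (-ρ₁ - δ) + ((-1 / 2 * u : ℝ) : ℂ) * Complex.I =
            ((h : ℂ) + c₁ - ((σ : ℂ) + (u : ℂ) * Complex.I)) / 2 by push_cast; ring,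
      show ρ₁ + δ + (h + c₁ - σ) / 2 + (-c₁ - ρ₁ - δ) + ((-1 / 2 * u : ℝ) : ℂ) * Complex.I =
            ((h : ℂ) - c₁ - ((σ : ℂ) + (u : ℂ) * Complex.I)) / 2 by push_cast; ring,
      show ρ₁ + δ + (h + c₁ - σ) / 2 + ((Δ + c₀ + c₁) / 2 + ρ₀ + ρ₁ + δ + (-c₀ - ρ₀)) +
          (-ρ₁ - δ) + (-c₁ - ρ₁ - δ) + ((-1 / 2 * u : ℝ) : ℂ) * Complex.I =
            (Δ + (h : ℂ) - c₀ - ((σ : ℂ) + (u : ℂ) * Complex.I)) / 2 by push_cast; ring]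
    rw [div_eq_mul_inv, div_eq_mul_inv, mul_inv _ (Γ ((Δ + (h : ℂ) - c₀ - _) / 2))]
    ring
  rw [hL]
  have g1 := Complex.Gamma_ne_zero h₁
  have g2 := Complex.Gamma_ne_zero h₂
  have g3 := Complex.Gamma_ne_zero h₃
  have g4 := Complex.Gamma_ne_zero h₄
  have g5 := Complex.Gamma_ne_zero h₅
  have g6 := Complex.Gamma_ne_zero h₆
  have g7 := Complex.Gamma_ne_zero h₇
  have g8 := Complex.Gamma_ne_zero h₈
  have g9 := Complex.Gamma_ne_zero h₉
  have hpi0 : (Real.pi : ℂ) ≠ 0 := by exact_mod_cast Real.pi_ne_zero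
  have hDe : D = Γ (((h : ℂ) + c₀ - s₀) / 2) *
      (2 * Real.pi * (Γ ((Δ - c₀ + c₁) / 2) * Γ ((Δ - c₀ - c₁) / 2))) * (∫ v : ℝ, g v) /
        Γ ((Δ - s₀ + s₁) / 2) := by
    rw [eq_div_iff g9]
    exact key
  rw [hDe]
  generalize (∫ v : ℝ, g v) = J
  generalize Γ (((h : ℂ) + c₀ - s₀) / 2) = G1 at *
  generalize Γ (((h : ℂ) - c₀ - s₀) / 2) = G2 at *
  generalize Γ (((h : ℂ) + c₁ - s₁) / 2) = G3 at *
  generalize Γ (((h : ℂ) - c₁ - s₁) / 2) = G4 at *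
  generalize Γ ((Δ + c₀ + c₁) / 2) = G5 at *
  generalize Γ ((Δ + c₀ - c₁) / 2) = G6 at *
  generalize Γ ((Δ - c₀ + c₁) / 2) = G7 at *
  generalize Γ ((Δ - c₀ - c₁) / 2) = G8 at *
  generalize Γ ((Δ - s₀ + s₁) / 2) = G9 at *
  field_simp
end

section
/- Three-point Symanzik star formula: let Δ₁, Δ₂, Δ₃ be complex numbers and P₁₂, P₁₃, P₂₃ positive real numbers. Set δ₁₂ = (Δ₁+Δ₂−Δ₃)/2, δ₁₃ = (Δ₁+Δ₃−Δ₂)/2, δ₂₃ = (Δ₂+Δ₃−Δ₁)/2, and assume Re δ₁₂ > 0, Re δ₁₃ > 0, Re δ₂₃ > 0. Then ∫_{(0,∞)³} α₁^{Δ₁−1}·α₂^{Δ₂−1}·α₃^{Δ₃−1}·exp(−α₁α₂P₁₂ − α₁α₃P₁₃ − α₂α₃P₂₃) dα₁ dα₂ dα₃ = (1/2)·Γ(δ₁₂)·Γ(δ₁₃)·Γ(δ₂₃)·P₁₂^{−δ₁₂}·P₁₃^{−δ₁₃}·P₂₃^{−δ₂₃}. -/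
open MeasureTheory

local notation "Γ" => Complex.Gamma

/-- The change of variables sending `α` to the pairwise products. -/
noncomputable def pairMap (α : ℝ × ℝ × ℝ) : ℝ × ℝ × ℝ :=
  (α.1 * α.2.1, α.1 * α.2.2, α.2.1 * α.2.2)

/-- Derivative of `pairMap`. -/
noncomputable def pairDeriv (α : ℝ × ℝ × ℝ) : (ℝ × ℝ × ℝ) →L[ℝ] (ℝ × ℝ × ℝ) :=
  let p1 := ContinuousLinearMap.fst ℝ ℝ (ℝ × ℝ)
  let p2 := (ContinuousLinearMap.fst ℝ ℝ ℝ).comp (ContinuousLinearMap.snd ℝ ℝ (ℝ × ℝ))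
  let p3 := (ContinuousLinearMap.snd ℝ ℝ ℝ).comp (ContinuousLinearMap.snd ℝ ℝ (ℝ × ℝ))
  (α.1 • p2 + α.2.1 • p1).prod ((α.1 • p3 + α.2.2 • p1).prod (α.2.1 • p3 + α.2.2 • p2))

lemma hasFDerivAt_pairMap (α : ℝ × ℝ × ℝ) : HasFDerivAt pairMap (pairDeriv α) α := by
  have p1 : HasFDerivAt (fun x : ℝ × ℝ × ℝ => x.1) (ContinuousLinearMap.fst ℝ ℝ (ℝ × ℝ)) α :=
    hasFDerivAt_fst
  have h2 : HasFDerivAt (fun x : ℝ × ℝ × ℝ => x.2) (ContinuousLinearMap.snd ℝ ℝ (ℝ × ℝ)) α :=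
    hasFDerivAt_snd
  have p2 : HasFDerivAt (fun x : ℝ × ℝ × ℝ => x.2.1) _ α := h2.fst
  have p3 : HasFDerivAt (fun x : ℝ × ℝ × ℝ => x.2.2) _ α := h2.snd
  exact (p1.mul p2).prodMk ((p1.mul p3).prodMk (p2.mul p3))

/-- Coordinates on the triple product. -/
noncomputable def tripleEquiv : (ℝ × ℝ × ℝ) ≃ₗ[ℝ] (Fin 3 → ℝ) where
  toFun x := ![x.1, x.2.1, x.2.2]
  invFun v := (v 0, v 1, v 2)
  map_add' x y := by ext i; fin_cases i <;> simp
  map_smul' c x := by ext i; fin_cases i <;> simp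
  left_inv x := by simp
  right_inv v := by ext i; fin_cases i <;> simp

lemma det_pairDeriv (α : ℝ × ℝ × ℝ) :
    (pairDeriv α).det = -(2 * (α.1 * α.2.1 * α.2.2)) := by
  rw [ContinuousLinearMap.det, ← LinearMap.det_toMatrix (Module.Basis.ofEquivFun tripleEquiv),
    Matrix.det_fin_three]
  simp [LinearMap.toMatrix_apply, Module.Basis.ofEquivFun, tripleEquiv, pairDeriv]
  ring

lemma injOn_pairMap :
    Set.InjOn pairMap (Set.Ioi (0 : ℝ) ×ˢ (Set.Ioi (0 : ℝ) ×ˢ Set.Ioi (0 : ℝ))) := by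
  rintro ⟨a, b, c⟩ ⟨ha, hb, hc⟩ ⟨x, y, z⟩ ⟨hx, hy, hz⟩ h
  simp only [pairMap, Prod.mk.injEq, Set.mem_Ioi] at *
  obtain ⟨h1, h2, h3⟩ := h
  have hax : a = x := by
    have : a ^ 2 * (b * c) = x ^ 2 * (b * c) := by
      calc a ^ 2 * (b * c) = (a * b) * (a * c) := by ring
        _ = x ^ 2 * (y * z) := by rw [h1, h2]; ring
        _ = _ := by rw [h3]
    have := mul_right_cancel₀ (mul_pos hb hc).ne' this
    exact (pow_left_inj₀ ha.le hx.le two_ne_zero).1 this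
  subst hax
  exact ⟨rfl, mul_left_cancel₀ ha.ne' h1, mul_left_cancel₀ ha.ne' h2⟩

lemma image_pairMap :
    pairMap '' (Set.Ioi (0 : ℝ) ×ˢ (Set.Ioi (0 : ℝ) ×ˢ Set.Ioi (0 : ℝ))) =
      Set.Ioi (0 : ℝ) ×ˢ (Set.Ioi (0 : ℝ) ×ˢ Set.Ioi (0 : ℝ)) := by
  ext ⟨s, t, r⟩
  constructor
  · rintro ⟨⟨a, b, c⟩, ⟨ha, hb, hc⟩, h⟩
    simp only [pairMap, Prod.mk.injEq, Set.mem_Ioi] at *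
    obtain ⟨rfl, rfl, rfl⟩ := h
    exact ⟨mul_pos ha hb, mul_pos ha hc, mul_pos hb hc⟩
  · rintro ⟨hs, ht, hr⟩
    simp only [Set.mem_Ioi] at hs ht hr
    have hq : 0 < s * t / r := by positivity
    have ha : 0 < √(s * t / r) := Real.sqrt_pos.2 hq
    have hsq : √(s * t / r) * √(s * t / r) = s * t / r := Real.mul_self_sqrt hq.le
    refine ⟨(√(s * t / r), s / √(s * t / r), t / √(s * t / r)),
      ⟨ha, div_pos hs ha, div_pos ht ha⟩, ?_⟩
    simp only [pairMap, Prod.mk.injEq]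
    refine ⟨by field_simp, by field_simp, ?_⟩
    rw [div_mul_div_comm, hsq]
    field_simp

lemma cpow_combine {a : ℝ} (ha : 0 < a) (x y z : ℂ) (h : x + y = z) :
    (a : ℂ) * ((a : ℂ) ^ (x - 1) * (a : ℂ) ^ (y - 1)) = (a : ℂ) ^ (z - 1) := by
  have h0 : (a : ℂ) ≠ 0 := by exact_mod_cast ha.ne'
  rw [← Complex.cpow_add _ _ h0]
  nth_rewrite 1 [← Complex.cpow_one (a : ℂ)]
  rw [← Complex.cpow_add _ _ h0, ← h]
  congr 1; ring

lemma gamma_piece {P : ℝ} (hP : 0 < P) {d : ℂ} (hd : 0 < d.re) :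
    ∫ t in Set.Ioi (0 : ℝ), (t : ℂ) ^ (d - 1) * Complex.exp (-(P * t)) =
      (P : ℂ) ^ (-d) * Complex.Gamma d := by
  rw [Complex.integral_cpow_mul_exp_neg_mul_Ioi hd (by simpa using hP), one_div,
    Complex.inv_cpow _ _ (by rw [Complex.arg_ofReal_of_nonneg hP.le]; exact Real.pi_pos.ne),
    Complex.cpow_neg]

/-- **Three-point Symanzik star formula** (the `n = 3` case of the paper's eq. (1.4)):
the Mellin variables `δ_{ij}` are completely fixed by the constraints, so no Mellin
integration remains, and the Schwinger-parameter integral evaluates, including the overall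
factor `1/2`, to a product of Gamma functions and powers. -/
theorem symanzik_three_point
    (Δ₁ Δ₂ Δ₃ : ℂ) (P₁₂ P₁₃ P₂₃ : ℝ)
    (hP₁₂ : 0 < P₁₂) (hP₁₃ : 0 < P₁₃) (hP₂₃ : 0 < P₂₃)
    (h₁₂ : 0 < ((Δ₁ + Δ₂ - Δ₃) / 2).re)
    (h₁₃ : 0 < ((Δ₁ + Δ₃ - Δ₂) / 2).re)
    (h₂₃ : 0 < ((Δ₂ + Δ₃ - Δ₁) / 2).re) :
    (∫ α in Set.Ioi (0 : ℝ) ×ˢ (Set.Ioi (0 : ℝ) ×ˢ Set.Ioi (0 : ℝ)),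
        (α.1 : ℂ) ^ (Δ₁ - 1) * (α.2.1 : ℂ) ^ (Δ₂ - 1) * (α.2.2 : ℂ) ^ (Δ₃ - 1) *
          Complex.exp
            (-(α.1 * α.2.1 * P₁₂ + α.1 * α.2.2 * P₁₃ + α.2.1 * α.2.2 * P₂₃ : ℂ))) =
      (1 / 2) * Γ ((Δ₁ + Δ₂ - Δ₃) / 2) * Γ ((Δ₁ + Δ₃ - Δ₂) / 2) * Γ ((Δ₂ + Δ₃ - Δ₁) / 2) *
        (P₁₂ : ℂ) ^ (-((Δ₁ + Δ₂ - Δ₃) / 2)) * (P₁₃ : ℂ) ^ (-((Δ₁ + Δ₃ - Δ₂) / 2)) *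
        (P₂₃ : ℂ) ^ (-((Δ₂ + Δ₃ - Δ₁) / 2)) := by
  have e1 : (Δ₁ + Δ₂ - Δ₃) / 2 + (Δ₁ + Δ₃ - Δ₂) / 2 = Δ₁ := by ring
  have e2 : (Δ₁ + Δ₂ - Δ₃) / 2 + (Δ₂ + Δ₃ - Δ₁) / 2 = Δ₂ := by ring
  have e3 : (Δ₁ + Δ₃ - Δ₂) / 2 + (Δ₂ + Δ₃ - Δ₁) / 2 = Δ₃ := by ring
  generalize (Δ₁ + Δ₂ - Δ₃) / 2 = d at *
  generalize (Δ₁ + Δ₃ - Δ₂) / 2 = e at *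
  generalize (Δ₂ + Δ₃ - Δ₁) / 2 = f at *
  have hmeas : MeasurableSet (Set.Ioi (0 : ℝ) ×ˢ (Set.Ioi (0 : ℝ) ×ˢ Set.Ioi (0 : ℝ))) :=
    measurableSet_Ioi.prod (measurableSet_Ioi.prod measurableSet_Ioi)
  let F : ℝ → ℂ → ℝ → ℂ := fun P d t => (t : ℂ) ^ (d - 1) * Complex.exp (-(P * t))
  haveI i2 : (volume : Measure (ℝ × ℝ)).IsAddHaarMeasure :=
    inferInstanceAs (((volume : Measure ℝ).prod (volume : Measure ℝ)).IsAddHaarMeasure)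
  haveI i3 : (volume : Measure (ℝ × ℝ × ℝ)).IsAddHaarMeasure :=
    inferInstanceAs (((volume : Measure ℝ).prod (volume : Measure (ℝ × ℝ))).IsAddHaarMeasure)
  have key := integral_image_eq_integral_abs_det_fderiv_smul volume hmeas
    (fun x _ => (hasFDerivAt_pairMap x).hasFDerivWithinAt) injOn_pairMap
    (fun x => F P₁₂ d x.1 * (F P₁₃ e x.2.1 * F P₂₃ f x.2.2))
  have prodI : (∫ x in Set.Ioi (0 : ℝ) ×ˢ (Set.Ioi (0 : ℝ) ×ˢ Set.Ioi (0 : ℝ)),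
      F P₁₂ d x.1 * (F P₁₃ e x.2.1 * F P₂₃ f x.2.2)) =
      (∫ t in Set.Ioi (0 : ℝ), F P₁₂ d t) * ((∫ t in Set.Ioi (0 : ℝ), F P₁₃ e t) *
        (∫ t in Set.Ioi (0 : ℝ), F P₂₃ f t)) := by
    rw [← setIntegral_prod_mul (F P₁₃ e) (F P₂₃ f),
      ← setIntegral_prod_mul (F P₁₂ d) (fun z : ℝ × ℝ => F P₁₃ e z.1 * F P₂₃ f z.2)]
    rfl
  rw [image_pairMap, prodI] at key
  simp only [F] at key
  rw [gamma_piece hP₁₂ h₁₂, gamma_piece hP₁₃ h₁₃, gamma_piece hP₂₃ h₂₃] at key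
  have lhs : ∀ I J : ℂ, J = 2 * I → I = (1 / 2) * J := by rintro I J rfl; ring
  refine (lhs _ _ (key.trans ?_)).trans (by ring)
  rw [← integral_const_mul]
  refine setIntegral_congr_fun hmeas ?_
  rintro ⟨a, b, c⟩ ⟨ha, hb, hc⟩
  simp only [Set.mem_Ioi] at ha hb hc
  have habc : 0 < 2 * (a * b * c) := by positivity
  simp only [det_pairDeriv, abs_neg, abs_of_pos habc, pairMap, Complex.real_smul,
    Complex.ofReal_mul, Complex.ofReal_ofNat,
    Complex.mul_cpow_ofReal_nonneg ha.le hb.le, Complex.mul_cpow_ofReal_nonneg ha.le hc.le,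
    Complex.mul_cpow_ofReal_nonneg hb.le hc.le]
  rw [← cpow_combine ha d e Δ₁ e1, ← cpow_combine hb d f Δ₂ e2, ← cpow_combine hc e f Δ₃ e3,
    show (-(a * b * P₁₂ + a * c * P₁₃ + b * c * P₂₃ : ℂ)) =
      -(P₁₂ * (a * b)) + (-(P₁₃ * (a * c)) + -(P₂₃ * (b * c))) by ring,
    Complex.exp_add, Complex.exp_add]
  ring
end

section
/- Four-point Symanzik star formula: let Δ₁, Δ₂, Δ₃, Δ₄ be complex numbers, let P_{ij} > 0 be positive reals for 1 ≤ i < j ≤ 4, and let σ_u, σ_v be real numbers satisfying σ_u > 0, σ_v > 0, Re Δ₁ − σ_u − σ_v > 0, Re(Δ₁+Δ₂+Δ₃−Δ₄)/2 − σ_u − σ_v > 0, Re(Δ₂+Δ₄−Δ₁−Δ₃)/2 + σ_v > 0 and Re(Δ₃+Δ₄−Δ₁−Δ₂)/2 + σ_u > 0. Then ∫_{(0,∞)⁴} ∏_{i=1}^{4} α_i^{Δ_i−1} · exp(−Σ_{1≤i<j≤4} α_iα_jP_{ij}) dα₁⋯dα₄ = (1/2)·(1/(2π))² ∫_{ℝ²}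 ∏_{1≤i<j≤4} Γ(δ_{ij})·P_{ij}^{−δ_{ij}} ds dt, where with u = σ_u + i·s and v = σ_v + i·t one sets δ₁₂ = u, δ₁₃ = v, δ₁₄ = Δ₁ − u − v, δ₂₃ = (Δ₁+Δ₂+Δ₃−Δ₄)/2 − u − v, δ₂₄ = (Δ₂+Δ₄−Δ₁−Δ₃)/2 + v, δ₃₄ = (Δ₃+Δ₄−Δ₁−Δ₂)/2 + u (this is the general solution of the constraints Σ_{j≠i} δ_{ij} = Δ_i in terms of two independent Mellin variables). -/
open MeasureTheory

local notation "Γ" => Complex.Gamma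

/-- `exp` transports `exp x dx` to Lebesgue measure on `(0,∞)`. -/
lemma sym_mp_exp : MeasurePreserving Real.exp
    ((volume : Measure ℝ).withDensity fun x => ENNReal.ofReal (Real.exp x))
    ((volume : Measure ℝ).restrict (Set.Ioi 0)) := by
  refine ⟨Real.measurable_exp, ?_⟩
  have h := map_withDensity_abs_det_fderiv_eq_addHaar (μ := (volume : Measure ℝ)) (s := Set.univ)
    (f := Real.exp) (f' := fun x => ContinuousLinearMap.toSpanSingleton ℝ (Real.exp x))
    MeasurableSet.univ.nullMeasurableSet
    (fun x _ => (Real.hasDerivAt_exp x).hasFDerivAt.hasFDerivWithinAt)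
    Real.exp_injective.injOn
  simpa [Set.image_univ, Real.range_exp] using h

lemma sym_int_exp (f : ℝ × ℝ × ℝ × ℝ → ℂ) :
    ∫ α in Set.Ioi (0 : ℝ) ×ˢ (Set.Ioi (0 : ℝ) ×ˢ (Set.Ioi (0 : ℝ) ×ˢ Set.Ioi (0 : ℝ))), f α =
    ∫ x : ℝ × ℝ × ℝ × ℝ,
      ((Real.exp x.1 * (Real.exp x.2.1 * (Real.exp x.2.2.1 * Real.exp x.2.2.2)) : ℝ) : ℂ) *
      f (Real.exp x.1, Real.exp x.2.1, Real.exp x.2.2.1, Real.exp x.2.2.2) := by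
  have e : MeasurableEmbedding Real.exp :=
    Real.continuous_exp.measurableEmbedding Real.exp_injective
  have h := sym_mp_exp.prod (sym_mp_exp.prod (sym_mp_exp.prod sym_mp_exp))
  have he := e.prodMap (e.prodMap (e.prodMap e))
  have hm : Measurable fun x => ENNReal.ofReal (Real.exp x) := by fun_prop
  rw [Measure.prod_restrict, Measure.prod_restrict, Measure.prod_restrict,
    prod_withDensity hm hm, prod_withDensity hm (by fun_prop),
    prod_withDensity hm (by fun_prop)] at h
  have h2 := h.integral_comp he f
  rw [integral_withDensity_eq_integral_toReal_smul (by fun_prop)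
    (by filter_upwards with x; simp [ENNReal.mul_lt_top_iff])] at h2
  refine h2.symm.trans ?_
  refine integral_congr_ae ?_
  filter_upwards with x
  simp [ENNReal.toReal_mul, ENNReal.toReal_ofReal, (Real.exp_pos _).le, Prod.map]

lemma sym_int_exp1 (f : ℝ → ℂ) :
    ∫ α in Set.Ioi (0 : ℝ), f α = ∫ x : ℝ, (Real.exp x : ℂ) * f (Real.exp x) := by
  have e : MeasurableEmbedding Real.exp :=
    Real.continuous_exp.measurableEmbedding Real.exp_injective
  have h2 := sym_mp_exp.integral_comp e f
  rw [integral_withDensity_eq_integral_toReal_smul (by fun_prop)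
    (by filter_upwards with x; simp)] at h2
  refine h2.symm.trans ?_
  refine integral_congr_ae ?_
  filter_upwards with x
  simp [ENNReal.toReal_ofReal, (Real.exp_pos _).le]

lemma sym_integrable_exp1 (f : ℝ → ℂ) (hf : IntegrableOn f (Set.Ioi 0)) :
    Integrable (fun x : ℝ => (Real.exp x : ℂ) * f (Real.exp x)) := by
  have e : MeasurableEmbedding Real.exp :=
    Real.continuous_exp.measurableEmbedding Real.exp_injective
  have h2 := (sym_mp_exp.integrable_comp_emb e (g := f)).2 hf
  rw [integrable_withDensity_iff_integrable_smul' (by fun_prop)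
    (by filter_upwards with x; simp)] at h2
  refine h2.congr ?_
  filter_upwards with x
  simp [ENNReal.toReal_ofReal, (Real.exp_pos _).le]

lemma sym_cpow_exp (x : ℝ) (δ : ℂ) :
    (Real.exp x : ℂ) ^ δ = Complex.exp (δ * x) := by
  rw [Complex.cpow_def_of_ne_zero (by exact_mod_cast (Real.exp_pos x).ne'),
    ← Complex.ofReal_log (Real.exp_pos x).le, Real.log_exp, mul_comm]

lemma sym_exp_cpow (x : ℝ) (δ : ℂ) :
    (Real.exp x : ℂ) * (Real.exp x : ℂ) ^ (δ - 1) = Complex.exp (δ * x) := by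
  rw [sym_cpow_exp, Complex.ofReal_exp, ← Complex.exp_add]
  congr 1; ring

/-- One-dimensional building block in logarithmic coordinates. -/
noncomputable def symK (δ : ℂ) (P : ℝ) (y : ℝ) : ℂ :=
  Complex.exp (δ * y) * Complex.exp (-(P * Real.exp y : ℝ))

lemma symK_integrable (δ : ℂ) (P : ℝ) (hδ : 0 < δ.re) (hP : 0 < P) :
    Integrable (symK δ P) := by
  have h0 : IntegrableOn (fun t : ℝ => (t : ℂ) ^ (δ - 1) * Complex.exp (-(P * t : ℝ)))
      (Set.Ioi 0) := by
    have h1 := integrableOn_rpow_mul_exp_neg_mul_rpow (p := 1) (s := δ.re - 1) (b := P)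
      (by linarith) one_pos hP
    refine Integrable.mono' h1 ?_ ?_
    · refine ContinuousOn.aestronglyMeasurable ?_ measurableSet_Ioi
      refine ContinuousOn.mul ?_ (by fun_prop)
      intro t ht
      refine ContinuousAt.continuousWithinAt ?_
      exact (Complex.continuousAt_ofReal_cpow_const _ _ (Or.inr (ne_of_gt ht)))
    · filter_upwards [ae_restrict_mem measurableSet_Ioi] with t ht
      rw [norm_mul, Complex.norm_cpow_eq_rpow_re_of_pos ht, Complex.norm_exp]
      simp
  refine (sym_integrable_exp1 _ h0).congr ?_
  filter_upwards with x
  rw [← mul_assoc, sym_exp_cpow]; rfl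

lemma symK_integral (δ : ℂ) (P : ℝ) (hδ : 0 < δ.re) (hP : 0 < P) :
    ∫ y, symK δ P y = Complex.Gamma δ * (P : ℂ) ^ (-δ) := by
  have h := Complex.integral_cpow_mul_exp_neg_mul_Ioi hδ hP
  rw [sym_int_exp1] at h
  have h2 : ((1 : ℂ) / P) ^ δ = (P : ℂ) ^ (-δ) := by
    rw [one_div, Complex.inv_cpow _ _ (by
      rw [Complex.arg_ofReal_of_nonneg hP.le]; exact Real.pi_pos.ne), Complex.cpow_neg]
  rw [h2, mul_comm] at h
  rw [← h]
  refine integral_congr_ae ?_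
  filter_upwards with x
  rw [← mul_assoc, sym_exp_cpow]; simp [symK]

lemma symGamma_integrable (σ : ℝ) (hσ : 0 < σ) :
    Integrable (fun t : ℝ => Complex.Gamma (σ + t * Complex.I)) := by
  have hc : Continuous (fun t : ℝ => Complex.Gamma (σ + t * Complex.I)) := by
    rw [continuous_iff_continuousAt]
    intro t
    have h1 : ContinuousAt Complex.Gamma (σ + t * Complex.I) := by
      refine (Complex.differentiableAt_Gamma _ ?_).continuousAt
      intro m hm
      have := congrArg Complex.re hm
      simp at this
      have hm0 : (0 : ℝ) ≤ m := m.cast_nonneg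
      linarith
    exact ContinuousAt.comp (f := fun t : ℝ => (σ + t * Complex.I : ℂ)) h1 (by fun_prop)
  obtain ⟨c, hc0, hcσ⟩ : ∃ c : ℝ, 0 < c ∧ ∀ t : ℝ, c * (1 + t ^ 2) ≤ σ ^ 2 + t ^ 2 := by
    refine ⟨min 1 (σ ^ 2), by positivity, fun t => ?_⟩
    have a := min_le_left 1 (σ ^ 2)
    have b := min_le_right 1 (σ ^ 2)
    nlinarith [sq_nonneg t]
  refine Integrable.mono' (integrable_inv_one_add_sq.const_mul (Real.Gamma (σ + 2) / c))
    hc.aestronglyMeasurable ?_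
  filter_upwards with t
  set s : ℂ := σ + t * Complex.I with hs
  have hre : s.re = σ := by simp [hs]
  have him : s.im = t := by simp [hs]
  have hs0 : s ≠ 0 := fun h => by rw [h] at hre; simp at hre; linarith
  have hs1 : s + 1 ≠ 0 := fun h => by
    have := congrArg Complex.re h; simp [hre] at this; linarith
  have e : Complex.Gamma (s + 2) = (s + 1) * (s * Complex.Gamma s) := by
    rw [← Complex.Gamma_add_one s hs0, ← Complex.Gamma_add_one _ hs1]; congr 1; ring
  have hG : ‖Complex.Gamma (s + 2)‖ ≤ Real.Gamma (σ + 2) := by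
    rw [Complex.Gamma_eq_integral (by simp [hre]; linarith), Real.Gamma_eq_integral (by linarith),
      Complex.GammaIntegral]
    refine (norm_integral_le_integral_norm _).trans (le_of_eq ?_)
    refine setIntegral_congr_fun measurableSet_Ioi fun x hx => ?_
    simp only [norm_mul, Complex.norm_cpow_eq_rpow_re_of_pos hx]
    simp [hre, Complex.norm_exp]
  have n0 : ‖s‖ ^ 2 = σ ^ 2 + t ^ 2 := by
    rw [Complex.sq_norm, Complex.normSq_apply, hre, him]; ring
  have n1 : ‖s‖ ≤ ‖s + 1‖ := by
    refine le_of_sq_le_sq ?_ (norm_nonneg _)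
    rw [Complex.sq_norm, Complex.sq_norm, Complex.normSq_apply, Complex.normSq_apply]
    simp [hre, him]; nlinarith
  rw [e, norm_mul, norm_mul] at hG
  have key : c * (1 + t ^ 2) * ‖Complex.Gamma s‖ ≤ Real.Gamma (σ + 2) := by
    refine le_trans ?_ hG
    rw [← mul_assoc]
    refine mul_le_mul_of_nonneg_right ?_ (norm_nonneg _)
    nlinarith [hcσ t, norm_nonneg s]
  have hp : 0 < 1 + t ^ 2 := by positivity
  rw [← div_eq_mul_inv, div_div, le_div_iff₀ (by positivity)]
  linarith

lemma symGP_integrable (σ P : ℝ) (hσ : 0 < σ) (hP : 0 < P) :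
    Integrable (fun t : ℝ => Complex.Gamma (σ + t * Complex.I) *
      (P : ℂ) ^ (-(σ + t * Complex.I) : ℂ)) := by
  refine (symGamma_integrable σ hσ).mul_bdd (c := P ^ (-σ)) ?_ ?_
  · refine Continuous.aestronglyMeasurable ?_
    refine Continuous.const_cpow (by fun_prop) (Or.inl (by exact_mod_cast hP.ne'))
  · filter_upwards with t
    rw [Complex.norm_cpow_eq_rpow_re_of_pos hP]; simp

/-- Cahen–Mellin. -/
lemma sym_cahen (σ P y : ℝ) (hσ : 0 < σ) (hP : 0 < P) :
    Complex.exp (-(P * Real.exp y : ℝ)) = (1 / (2 * (Real.pi : ℂ))) *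
      ∫ t : ℝ, Complex.Gamma (σ + t * Complex.I) *
      (P : ℂ) ^ (-(σ + t * Complex.I) : ℂ) * Complex.exp (-(σ + t * Complex.I) * y) := by
  have hx : 0 < P * Real.exp y := by positivity
  have hM : ∀ s : ℂ, 0 < s.re →
      mellin (fun x : ℝ => ((Real.exp (-x) : ℝ) : ℂ)) s = Complex.Gamma s := fun s hs => by
    rw [Complex.Gamma_eq_integral hs, Complex.GammaIntegral_eq_mellin]
  have h := mellinInv_mellin_eq σ (fun x : ℝ => ((Real.exp (-x) : ℝ) : ℂ)) hx ?_ ?_ (by fun_prop)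
  · rw [mellinInv] at h
    simp only [smul_eq_mul] at h
    rw [← Complex.ofReal_neg, ← Complex.ofReal_exp, ← h]
    rw [Complex.real_smul]
    congr 1
    · push_cast; rfl
    refine integral_congr_ae ?_
    filter_upwards with t
    rw [hM _ (by simp [hσ]), Complex.ofReal_mul,
      Complex.mul_cpow_ofReal_nonneg hP.le (Real.exp_pos y).le, sym_cpow_exp]
    ring
  · have := Complex.GammaIntegral_convergent (s := σ) (by simpa using hσ)
    refine this.congr ?_
    filter_upwards with t
    simp [mul_comm]
  · refine (symGamma_integrable σ hσ).congr ?_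
    filter_upwards with t
    rw [hM _ (by simp [hσ])]

lemma sym_shear {R : Type*} [MeasureSpace R] [SFinite (volume : Measure R)] (g : R → ℝ)
    (hg : Measurable g) :
    MeasurePreserving (fun p : ℝ × R => (p.1 + g p.2, p.2)) volume volume := by
  have h : MeasurePreserving (fun p : R × ℝ => (p.1, p.2 + g p.1))
      ((volume : Measure R).prod volume) ((volume : Measure R).prod volume) :=
    MeasurePreserving.skew_product (f := id) (g := fun a c => c + g a)
      (MeasurePreserving.id _) (by fun_prop)
      (by filter_upwards with a; exact (measurePreserving_add_right volume (g a)).map_eq)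
  exact Measure.measurePreserving_swap.comp (h.comp Measure.measurePreserving_swap)

lemma sym_mpT : MeasurePreserving (fun x : ℝ × ℝ × ℝ × ℝ =>
    (x.1 + x.2.2.2, x.2.1 + x.2.2.2, x.2.2.1 + x.2.2.2, (x.2.1 + x.2.2.1) / 2))
    volume volume := by
  have a1 := sym_shear (R := ℝ × ℝ × ℝ) (fun r => r.2.2) (by fun_prop)
  have a2 := (MeasurePreserving.id (volume : Measure ℝ)).prod
    (sym_shear (R := ℝ × ℝ) (fun r => r.2) (by fun_prop))
  have a3 := (MeasurePreserving.id (volume : Measure ℝ)).prod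
    ((MeasurePreserving.id (volume : Measure ℝ)).prod
    (sym_shear (R := ℝ) (fun r => r) (by fun_prop)))
  have b : ∀ y : ℝ, MeasurePreserving (fun p : ℝ × ℝ => (p.1, (y + p.1) / 2 - p.2))
      ((volume : Measure ℝ).prod volume) ((volume : Measure ℝ).prod volume) := fun y =>
    MeasurePreserving.skew_product (f := id) (g := fun a c => (y + a) / 2 - c)
      (MeasurePreserving.id _) (by fun_prop)
      (by filter_upwards with a; exact (Measure.measurePreserving_sub_left volume _).map_eq)
  have b2 : MeasurePreserving (fun p : ℝ × ℝ × ℝ => (p.1, (p.2.1, (p.1 + p.2.1) / 2 - p.2.2)))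
      ((volume : Measure ℝ).prod ((volume : Measure ℝ).prod volume))
      ((volume : Measure ℝ).prod ((volume : Measure ℝ).prod volume)) :=
    MeasurePreserving.skew_product (f := id) (g := fun (a : ℝ) (c : ℝ × ℝ) => (c.1, (a + c.1) / 2 - c.2))
      (MeasurePreserving.id _) (by fun_prop)
      (by filter_upwards with a; exact (b a).map_eq)
  have b3 := (MeasurePreserving.id (volume : Measure ℝ)).prod b2
  have h := b3.comp (a3.comp (a2.comp a1))
  have hf : (fun x : ℝ × ℝ × ℝ × ℝ =>
      (x.1 + x.2.2.2, x.2.1 + x.2.2.2, x.2.2.1 + x.2.2.2, (x.2.1 + x.2.2.1) / 2)) =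
      fun x => (x.1 + x.2.2.2, x.2.1 + x.2.2.2, x.2.2.1 + x.2.2.2,
        ((x.2.1 + x.2.2.2) + (x.2.2.1 + x.2.2.2)) / 2 - x.2.2.2) := by
    funext x
    have e : (x.2.1 + x.2.2.1) / 2 =
      ((x.2.1 + x.2.2.2) + (x.2.2.1 + x.2.2.2)) / 2 - x.2.2.2 := by ring
    rw [e]
  rw [hf]
  exact h

/-- The integrand left after splitting off the `12` and `13` factors. -/
noncomputable def symPhi (a b c d : ℂ) (P₁₄ P₂₃ P₂₄ P₃₄ : ℝ) (x : ℝ × ℝ × ℝ × ℝ) : ℂ :=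
  symK a P₁₄ (x.1 + x.2.2.2) * (symK c P₂₄ (x.2.1 + x.2.2.2) *
    (symK d P₃₄ (x.2.2.1 + x.2.2.2) * symK b P₂₃ (x.2.1 + x.2.2.1)))

lemma symPhi_aux (a b c d : ℂ) (P₁₄ P₂₃ P₂₄ P₃₄ : ℝ)
    (ha : 0 < a.re) (hb : 0 < b.re) (hc : 0 < c.re) (hd : 0 < d.re)
    (hP₁₄ : 0 < P₁₄) (hP₂₃ : 0 < P₂₃) (hP₂₄ : 0 < P₂₄) (hP₃₄ : 0 < P₃₄) :
    Integrable (symPhi a b c d P₁₄ P₂₃ P₂₄ P₃₄) ∧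
    ∫ x, symPhi a b c d P₁₄ P₂₃ P₂₄ P₃₄ x = (1 / 2) *
      ((Complex.Gamma a * (P₁₄ : ℂ) ^ (-a)) * ((Complex.Gamma c * (P₂₄ : ℂ) ^ (-c)) *
      ((Complex.Gamma d * (P₃₄ : ℂ) ^ (-d)) * (Complex.Gamma b * (P₂₃ : ℂ) ^ (-b))))) := by
  let G : ℝ × ℝ × ℝ × ℝ → ℂ := fun y =>
    symK a P₁₄ y.1 * (symK c P₂₄ y.2.1 * (symK d P₃₄ y.2.2.1 * symK b P₂₃ (2 * y.2.2.2)))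
  have hG : Integrable G :=
    (symK_integrable a P₁₄ ha hP₁₄).mul_prod ((symK_integrable c P₂₄ hc hP₂₄).mul_prod
      ((symK_integrable d P₃₄ hd hP₃₄).mul_prod
        ((symK_integrable b P₂₃ hb hP₂₃).comp_mul_left' two_ne_zero)))
  have hcomp : symPhi a b c d P₁₄ P₂₃ P₂₄ P₃₄ = G ∘ (fun x : ℝ × ℝ × ℝ × ℝ =>
    (x.1 + x.2.2.2, x.2.1 + x.2.2.2, x.2.2.1 + x.2.2.2, (x.2.1 + x.2.2.1) / 2)) := by
    funext x
    simp only [symPhi, G, Function.comp]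
    rw [mul_div_cancel₀ _ (two_ne_zero)]
  constructor
  · rw [hcomp]
    exact sym_mpT.integrable_comp_of_integrable hG
  · have e1 : ∫ x, symPhi a b c d P₁₄ P₂₃ P₂₄ P₃₄ x = ∫ y, G y := by
      conv_rhs => rw [← sym_mpT.map_eq]
      rw [integral_map sym_mpT.measurable.aemeasurable
        (by rw [sym_mpT.map_eq]; exact hG.aestronglyMeasurable), hcomp]
      rfl
    have e2 : ∫ y, G y = (∫ y, symK a P₁₄ y) * ((∫ y, symK c P₂₄ y) *
        ((∫ y, symK d P₃₄ y) * ∫ y, symK b P₂₃ (2 * y))) := by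
      rw [← integral_prod_mul, ← integral_prod_mul, ← integral_prod_mul]
      rfl
    rw [e1, e2, Measure.integral_comp_mul_left, symK_integral a P₁₄ ha hP₁₄,
      symK_integral b P₂₃ hb hP₂₃, symK_integral c P₂₄ hc hP₂₄, symK_integral d P₃₄ hd hP₃₄,
      Complex.real_smul, abs_of_pos (by norm_num)]
    push_cast
    ring

/-- **Four-point Symanzik star formula** (the `n = 4` case of the paper's eq. (1.4)):
the Schwinger-parameter integral over `(0,∞)⁴` equals a two-fold Mellin–Barnes integral of
`∏_{i<j} Γ(δ_{ij}) P_{ij}^{−δ_{ij}}`, where the `δ_{ij}` solve the constraints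
`Σ_{j≠i} δ_{ij} = Δ_i` in terms of the two independent Mellin variables
`u = σᵤ + i s`, `v = σᵥ + i t`, and the overall coefficient is `1/2`. -/
theorem symanzik_four_point
    (Δ₁ Δ₂ Δ₃ Δ₄ : ℂ) (P₁₂ P₁₃ P₁₄ P₂₃ P₂₄ P₃₄ : ℝ)
    (hP₁₂ : 0 < P₁₂) (hP₁₃ : 0 < P₁₃) (hP₁₄ : 0 < P₁₄)
    (hP₂₃ : 0 < P₂₃) (hP₂₄ : 0 < P₂₄) (hP₃₄ : 0 < P₃₄)
    (σu σv : ℝ) (hσu : 0 < σu) (hσv : 0 < σv)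
    (h₁ : 0 < Δ₁.re - σu - σv)
    (h₂ : 0 < ((Δ₁ + Δ₂ + Δ₃ - Δ₄) / 2).re - σu - σv)
    (h₃ : 0 < ((Δ₂ + Δ₄ - Δ₁ - Δ₃) / 2).re + σv)
    (h₄ : 0 < ((Δ₃ + Δ₄ - Δ₁ - Δ₂) / 2).re + σu) :
    (∫ α in Set.Ioi (0 : ℝ) ×ˢ (Set.Ioi (0 : ℝ) ×ˢ (Set.Ioi (0 : ℝ) ×ˢ Set.Ioi (0 : ℝ))),
        (α.1 : ℂ) ^ (Δ₁ - 1) * (α.2.1 : ℂ) ^ (Δ₂ - 1) * (α.2.2.1 : ℂ) ^ (Δ₃ - 1) *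
          (α.2.2.2 : ℂ) ^ (Δ₄ - 1) *
          Complex.exp
            (-(α.1 * α.2.1 * P₁₂ + α.1 * α.2.2.1 * P₁₃ + α.1 * α.2.2.2 * P₁₄ +
                α.2.1 * α.2.2.1 * P₂₃ + α.2.1 * α.2.2.2 * P₂₄ +
                α.2.2.1 * α.2.2.2 * P₃₄ : ℂ))) =
      (1 / 2) * (1 / (2 * (Real.pi : ℂ))) ^ 2 *
        (∫ q : ℝ × ℝ,
          let u : ℂ := (σu : ℂ) + (q.1 : ℂ) * Complex.I
          let v : ℂ := (σv : ℂ) + (q.2 : ℂ) * Complex.I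
          let δ₁₂ : ℂ := u
          let δ₁₃ : ℂ := v
          let δ₁₄ : ℂ := Δ₁ - u - v
          let δ₂₃ : ℂ := (Δ₁ + Δ₂ + Δ₃ - Δ₄) / 2 - u - v
          let δ₂₄ : ℂ := (Δ₂ + Δ₄ - Δ₁ - Δ₃) / 2 + v
          let δ₃₄ : ℂ := (Δ₃ + Δ₄ - Δ₁ - Δ₂) / 2 + u
          Γ δ₁₂ * (P₁₂ : ℂ) ^ (-δ₁₂) * (Γ δ₁₃ * (P₁₃ : ℂ) ^ (-δ₁₃)) *
            (Γ δ₁₄ * (P₁₄ : ℂ) ^ (-δ₁₄)) * (Γ δ₂₃ * (P₂₃ : ℂ) ^ (-δ₂₃)) *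
            (Γ δ₂₄ * (P₂₄ : ℂ) ^ (-δ₂₄)) * (Γ δ₃₄ * (P₃₄ : ℂ) ^ (-δ₃₄))) := by
  classical
  set A : ℝ × ℝ → ℂ := fun q =>
    (Complex.Gamma (σu + q.1 * Complex.I) * (P₁₂ : ℂ) ^ (-(σu + q.1 * Complex.I) : ℂ)) *
    (Complex.Gamma (σv + q.2 * Complex.I) * (P₁₃ : ℂ) ^ (-(σv + q.2 * Complex.I) : ℂ)) with hA
  have hAint : Integrable A :=
    (symGP_integrable σu P₁₂ hσu hP₁₂).mul_prod (symGP_integrable σv P₁₃ hσv hP₁₃)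
  let Φ : ℂ → ℂ → ℝ × ℝ × ℝ × ℝ → ℂ := fun u v =>
    symPhi (Δ₁ - u - v) ((Δ₁ + Δ₂ + Δ₃ - Δ₄) / 2 - u - v) ((Δ₂ + Δ₄ - Δ₁ - Δ₃) / 2 + v)
      ((Δ₃ + Δ₄ - Δ₁ - Δ₂) / 2 + u) P₁₄ P₂₃ P₂₄ P₃₄
  have hΦ : ∀ u v : ℂ, u.re = σu → v.re = σv → _ := fun u v hu hv =>
    symPhi_aux (Δ₁ - u - v) ((Δ₁ + Δ₂ + Δ₃ - Δ₄) / 2 - u - v) ((Δ₂ + Δ₄ - Δ₁ - Δ₃) / 2 + v)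
      ((Δ₃ + Δ₄ - Δ₁ - Δ₂) / 2 + u) P₁₄ P₂₃ P₂₄ P₃₄
      (by rw [Complex.sub_re, Complex.sub_re, hu, hv]; exact h₁)
      (by rw [Complex.sub_re, Complex.sub_re, hu, hv]; exact h₂)
      (by rw [Complex.add_re, hv]; exact h₃)
      (by rw [Complex.add_re, hu]; exact h₄) hP₁₄ hP₂₃ hP₂₄ hP₃₄
  -- the pure phase relating `Φ` on the contour to `Φ` at its real point
  have hphase : ∀ (u v u' v' : ℂ) (x : ℝ × ℝ × ℝ × ℝ), Φ (u + u') (v + v') x =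
      Φ u v x * Complex.exp (-u' * (x.1 + x.2.1 : ℝ) - v' * (x.1 + x.2.2.1 : ℝ)) := by
    intro u v u' v' x
    have key : ∀ e₁ e₂ e₃ e₄ f₁ f₂ f₃ f₄ r₁ r₂ r₃ r₄ z : ℂ, f₁ + f₂ + f₃ + f₄ =
        e₁ + e₂ + e₃ + e₄ + z →
        Complex.exp f₁ * r₁ * (Complex.exp f₂ * r₂ * (Complex.exp f₃ * r₃ *
          (Complex.exp f₄ * r₄))) =
        Complex.exp e₁ * r₁ * (Complex.exp e₂ * r₂ * (Complex.exp e₃ * r₃ *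
          (Complex.exp e₄ * r₄))) * Complex.exp z := by
      intro e₁ e₂ e₃ e₄ f₁ f₂ f₃ f₄ r₁ r₂ r₃ r₄ z h
      have h' := congrArg Complex.exp h
      simp only [Complex.exp_add] at h'
      linear_combination r₁ * r₂ * r₃ * r₄ * h'
    simp only [Φ, symPhi, symK]
    apply key
    push_cast
    ring
  let H : ℝ × ℝ × ℝ × ℝ → ℝ × ℝ → ℂ := fun x q =>
    Φ (σu + q.1 * Complex.I) (σv + q.2 * Complex.I) x * A q
  have hHint : Integrable (Function.uncurry H)
      ((volume : Measure (ℝ × ℝ × ℝ × ℝ)).prod (volume : Measure (ℝ × ℝ))) := by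
    have h0 := (hΦ σu σv (by simp) (by simp)).1.mul_prod hAint
    have h1 := h0.mul_bdd (c := 1) (g := fun z : (ℝ × ℝ × ℝ × ℝ) × (ℝ × ℝ) =>
      Complex.exp (-(z.2.1 * Complex.I) * (z.1.1 + z.1.2.1 : ℝ) -
        (z.2.2 * Complex.I) * (z.1.1 + z.1.2.2.1 : ℝ)))
      (Continuous.aestronglyMeasurable (by fun_prop)) (by
        filter_upwards with z
        rw [Complex.norm_exp]
        simp)
    refine h1.congr ?_
    filter_upwards with z
    simp only [Function.uncurry, H, hphase]
    simp only [Φ]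
    ring
  -- left-hand side, in logarithmic coordinates, via Cahen–Mellin
  have hL : ∀ x : ℝ × ℝ × ℝ × ℝ,
      ((Real.exp x.1 * (Real.exp x.2.1 * (Real.exp x.2.2.1 * Real.exp x.2.2.2)) : ℝ) : ℂ) *
      ((Real.exp x.1 : ℂ) ^ (Δ₁ - 1) * (Real.exp x.2.1 : ℂ) ^ (Δ₂ - 1) *
        (Real.exp x.2.2.1 : ℂ) ^ (Δ₃ - 1) * (Real.exp x.2.2.2 : ℂ) ^ (Δ₄ - 1) *
          Complex.exp
            (-((Real.exp x.1 : ℂ) * Real.exp x.2.1 * P₁₂ + Real.exp x.1 * Real.exp x.2.2.1 * P₁₃ +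
              Real.exp x.1 * Real.exp x.2.2.2 * P₁₄ +
                Real.exp x.2.1 * Real.exp x.2.2.1 * P₂₃ + Real.exp x.2.1 * Real.exp x.2.2.2 * P₂₄ +
                Real.exp x.2.2.1 * Real.exp x.2.2.2 * P₃₄ : ℂ))) =
      (1 / (2 * (Real.pi : ℂ))) ^ 2 * ∫ q, H x q := by
    intro x
    have c1 := sym_cahen σu P₁₂ (x.1 + x.2.1) hσu hP₁₂
    have c2 := sym_cahen σv P₁₃ (x.1 + x.2.2.1) hσv hP₁₃
    have e1 : ((Real.exp x.1 * (Real.exp x.2.1 * (Real.exp x.2.2.1 * Real.exp x.2.2.2)) : ℝ) : ℂ) *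
      ((Real.exp x.1 : ℂ) ^ (Δ₁ - 1) * (Real.exp x.2.1 : ℂ) ^ (Δ₂ - 1) *
        (Real.exp x.2.2.1 : ℂ) ^ (Δ₃ - 1) * (Real.exp x.2.2.2 : ℂ) ^ (Δ₄ - 1) *
          Complex.exp
            (-((Real.exp x.1 : ℂ) * Real.exp x.2.1 * P₁₂ + Real.exp x.1 * Real.exp x.2.2.1 * P₁₃ +
              Real.exp x.1 * Real.exp x.2.2.2 * P₁₄ +
                Real.exp x.2.1 * Real.exp x.2.2.1 * P₂₃ + Real.exp x.2.1 * Real.exp x.2.2.2 * P₂₄ +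
                Real.exp x.2.2.1 * Real.exp x.2.2.2 * P₃₄ : ℂ))) =
        Φ 0 0 x * (Complex.exp (-(P₁₂ * Real.exp (x.1 + x.2.1) : ℝ)) *
          Complex.exp (-(P₁₃ * Real.exp (x.1 + x.2.2.1) : ℝ))) := by
      have t1 := sym_exp_cpow x.1 Δ₁
      have t2 := sym_exp_cpow x.2.1 Δ₂
      have t3 := sym_exp_cpow x.2.2.1 Δ₃
      have t4 := sym_exp_cpow x.2.2.2 Δ₄
      have t5 : ∀ a b c d w a' b' c' d' : ℂ,
          (a * (b * (c * d))) * (a' * b' * c' * d' * w) =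
          (a * a') * (b * b') * (c * c') * (d * d') * w := by intros; ring
      rw [Complex.ofReal_mul, Complex.ofReal_mul, Complex.ofReal_mul, t5, t1, t2, t3, t4]
      simp only [Φ, symPhi, symK, ← Complex.exp_add]
      congr 1
      simp only [Real.exp_add]
      push_cast
      ring
    rw [e1, c1, c2]
    have e2 : ∀ I J c p : ℂ, p * ((c * I) * (c * J)) = c ^ 2 * (p * (I * J)) := by intros; ring
    rw [e2, ← integral_prod_mul, ← integral_const_mul]
    congr 1
    refine integral_congr_ae ?_
    filter_upwards with q
    have := hphase 0 0 (σu + q.1 * Complex.I) (σv + q.2 * Complex.I) x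
    rw [zero_add, zero_add] at this
    simp only [H, this, hA]
    rw [sub_eq_add_neg, Complex.exp_add, neg_mul (σv + q.2 * Complex.I : ℂ)]
    ring
  rw [sym_int_exp]
  simp only [hL]
  rw [integral_const_mul, integral_integral_swap hHint, mul_comm (1 / 2 : ℂ), mul_assoc,
    ← integral_const_mul (1 / 2 : ℂ)]
  congr 1
  refine integral_congr_ae ?_
  filter_upwards with q
  have := (hΦ (σu + q.1 * Complex.I) (σv + q.2 * Complex.I) (by simp) (by simp)).2
  simp only [H, Φ]
  rw [integral_mul_const, this]
  simp only [hA]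
  ring
end

section
/- Mellin–Barnes representation of the multivariate Beta-type integral produced by gluing r diagrams at one bulk vertex: let r ≥ 1 and let A, p₁, …, p_r, t₁, …, t_r be complex numbers with Re A > 0, Re pₐ > 0 and Re tₐ > Re pₐ for every a, and let ρ₁, …, ρ_r be real numbers with −Re pₐ < ρₐ < 0 for every a and ρ₁ + ⋯ + ρ_r > −Re A. Then Γ(A) · ∫_{(0,∞)^r} (1 + β₁ + ⋯ + β_r)^{−A} · ∏_{a=1}^{r} βₐ^{pₐ−1}·(1+βₐ)^{−tₐ} dβ₁⋯dβ_r = (1/(2π))^r ∫_{ℝ^r} Γ(A + w₁ + ⋯ + w_r) · ∏_{a=1}^{r} [Γ(−wₐ)·Γ(tₐ−pₐ−wₐ)·Γ(pₐ+wₐ)/Γ(tₐ)] du₁⋯du_r, where wₐ = ρₐ + i·uₐ. -/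
open MeasureTheory

local notation "Γ" => Complex.Gamma

lemma gv_gammaInt {s : ℂ} (hs : 0 < s.re) {r : ℝ} (hr : 0 < r) :
    IntegrableOn (fun x : ℝ => (x : ℂ) ^ (s - 1) * Complex.exp (-(r * x))) (Set.Ioi 0) := by
  apply Integrable.of_integral_ne_zero
  rw [Complex.integral_cpow_mul_exp_neg_mul_Ioi hs hr]
  refine mul_ne_zero ?_ (Complex.Gamma_ne_zero_of_re_pos hs)
  rw [Complex.cpow_ne_zero_iff]
  left
  have : (r : ℂ) ≠ 0 := by exact_mod_cast hr.ne'
  simpa using this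

lemma gv_norm_Gamma_le {s : ℂ} (hs : 0 < s.re) : ‖Γ s‖ ≤ Real.Gamma s.re := by
  rw [Complex.Gamma_eq_integral hs, Real.Gamma_eq_integral hs, Complex.GammaIntegral]
  refine (norm_integral_le_integral_norm _).trans (le_of_eq ?_)
  refine setIntegral_congr_fun measurableSet_Ioi fun x hx => ?_
  rw [norm_mul, Complex.norm_cpow_eq_rpow_re_of_pos hx, Complex.norm_real, Real.norm_eq_abs,
    Real.abs_exp]
  simp

lemma gv_contGamma {z : ℝ → ℂ} (hz : Continuous z) (h : ∀ u, 0 < (z u).re) :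
    Continuous fun u => Γ (z u) := by
  rw [continuous_iff_continuousAt]
  intro u
  refine ContinuousAt.comp (g := Γ) (f := z) ?_ hz.continuousAt
  refine (Complex.differentiableAt_Gamma _ fun m hm => ?_).continuousAt
  have := h u
  rw [hm] at this
  simp at this
  have h2 : (0 : ℝ) ≤ m := by positivity
  linarith

lemma gv_vertical {σ : ℝ} (hσ : 0 < σ) :
    Integrable fun u : ℝ => Γ ((σ : ℂ) + u * Complex.I) := by
  have hre : ∀ u : ℝ, ((σ : ℂ) + u * Complex.I).re = σ := by intro u; simp
  have hb : Integrable fun u : ℝ => (Real.Gamma (σ + 2) * (1 + (σ ^ 2)⁻¹)) * (1 + u ^ 2)⁻¹ :=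
    integrable_inv_one_add_sq.const_mul _
  refine hb.mono' (gv_contGamma (by fun_prop) fun u => by rw [hre]; exact hσ).aestronglyMeasurable
    (ae_of_all _ fun u => ?_)
  set s : ℂ := (σ : ℂ) + u * Complex.I with hs
  have hsre : s.re = σ := hre u
  have hs0 : s ≠ 0 := by intro h; rw [h] at hsre; simp at hsre; linarith
  have hs1 : s + 1 ≠ 0 := by
    intro h
    have : (s + 1).re = σ + 1 := by simp [hsre]
    rw [h] at this; simp at this; linarith
  have h2 : Γ (s + 1 + 1) = (s + 1) * (s * Γ s) := by
    rw [Complex.Gamma_add_one _ hs1, Complex.Gamma_add_one _ hs0]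
  have h3 : ‖Γ (s + 1 + 1)‖ ≤ Real.Gamma (σ + 2) := by
    have h4 : (s + 1 + 1).re = σ + 2 := by simp [hsre]; ring
    rw [← h4]
    exact gv_norm_Gamma_le (by rw [h4]; linarith)
  rw [h2, norm_mul, norm_mul] at h3
  have hn : ‖s‖ ^ 2 = σ ^ 2 + u ^ 2 := by
    rw [← Complex.normSq_eq_norm_sq, Complex.normSq_apply]; simp [hs]; ring
  have hn1 : ‖s + 1‖ ^ 2 = (σ + 1) ^ 2 + u ^ 2 := by
    rw [← Complex.normSq_eq_norm_sq, Complex.normSq_apply]; simp [hs]; ring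
  have hle : ‖s‖ ≤ ‖s + 1‖ := by
    apply le_of_sq_le_sq _ (norm_nonneg _) |> fun h => h
    rw [hn, hn1]; nlinarith
  have h5 : ‖s‖ ^ 2 * ‖Γ s‖ ≤ Real.Gamma (σ + 2) := by
    refine le_trans ?_ h3
    rw [pow_two, mul_assoc]
    gcongr
  rw [hn] at h5
  rw [← div_eq_mul_inv, le_div_iff₀ (by positivity)]
  have h6 : 1 + u ^ 2 ≤ (1 + (σ ^ 2)⁻¹) * (σ ^ 2 + u ^ 2) := by
    have : (σ ^ 2)⁻¹ * σ ^ 2 = 1 := by field_simp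
    have h7 : 0 ≤ (σ ^ 2)⁻¹ * u ^ 2 := by positivity
    nlinarith [sq_nonneg σ]
  calc ‖Γ s‖ * (1 + u ^ 2) ≤ ‖Γ s‖ * ((1 + (σ ^ 2)⁻¹) * (σ ^ 2 + u ^ 2)) := by gcongr
    _ = (1 + (σ ^ 2)⁻¹) * ((σ ^ 2 + u ^ 2) * ‖Γ s‖) := by ring
    _ ≤ (1 + (σ ^ 2)⁻¹) * Real.Gamma (σ + 2) := by gcongr
    _ = _ := by ring

lemma gv_vertical_neg {ρ : ℝ} (hρ : ρ < 0) :
    Integrable fun u : ℝ => Γ (-((ρ : ℂ) + u * Complex.I)) := by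
  have := (gv_vertical (σ := -ρ) (by linarith)).comp_neg
  refine this.congr (ae_of_all _ fun u => ?_)
  simp only
  congr 1
  push_cast; ring

lemma gv_expMB {ρ : ℝ} (hρ : ρ < 0) {y : ℝ} (hy : 0 < y) :
    Complex.exp (-(y : ℂ)) = (1 / (2 * (Real.pi : ℂ))) *
      ∫ u : ℝ, Γ (-((ρ : ℂ) + u * Complex.I)) * (y : ℂ) ^ ((ρ : ℂ) + u * Complex.I) := by
  have hm : ∀ s : ℂ, 0 < s.re → mellin (fun x : ℝ => Complex.exp (-(x : ℂ))) s = Γ s := by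
    intro s hs
    have := Complex.integral_cpow_mul_exp_neg_mul_Ioi hs one_pos
    simp only [Complex.ofReal_one, one_mul, div_one, Complex.one_cpow] at this
    rw [mellin, ← this]
    simp
  have hre : ∀ u : ℝ, 0 < (((-ρ : ℝ) : ℂ) + u * Complex.I).re := by intro u; simpa using hρ
  have h := mellinInv_mellin_eq (-ρ) (fun x : ℝ => Complex.exp (-(x : ℂ))) hy ?_ ?_ (by fun_prop)
  · rw [← h, mellinInv]
    have e : ∀ u : ℝ, (y : ℂ) ^ (-(((-ρ : ℝ) : ℂ) + u * Complex.I)) •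
        mellin (fun x : ℝ => Complex.exp (-(x : ℂ))) (((-ρ : ℝ) : ℂ) + u * Complex.I) =
        (fun v : ℝ => Γ (-((ρ : ℂ) + v * Complex.I)) * (y : ℂ) ^ ((ρ : ℂ) + v * Complex.I)) (-u) := by
      intro u
      rw [hm _ (hre u), smul_eq_mul, mul_comm]
      simp only
      congr 2 <;> (push_cast; ring)
    simp_rw [e]
    rw [integral_neg_eq_self (fun v : ℝ => Γ (-((ρ : ℂ) + v * Complex.I)) * (y : ℂ) ^ ((ρ : ℂ) + v * Complex.I)) volume]
    rw [Complex.real_smul]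
    push_cast; rfl
  · have := gv_gammaInt (s := ((-ρ : ℝ) : ℂ)) (by simpa using hρ) one_pos
    simpa [MellinConvergent] using this
  · have := gv_vertical (σ := -ρ) (by linarith)
    refine this.congr (ae_of_all _ fun u => ?_)
    exact (hm _ (hre u)).symm

lemma gv_beta {s t : ℂ} (hs : 0 < s.re) (hst : s.re < t.re) :
    IntegrableOn (fun b : ℝ => (b : ℂ) ^ (s - 1) * ((1 + b : ℝ) : ℂ) ^ (-t)) (Set.Ioi 0) ∧
    ∫ b in Set.Ioi (0 : ℝ), (b : ℂ) ^ (s - 1) * ((1 + b : ℝ) : ℂ) ^ (-t) =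
      Γ s * Γ (t - s) / Γ t := by
  have ht : 0 < t.re := hs.trans hst
  have hG : Γ t ≠ 0 := Complex.Gamma_ne_zero_of_re_pos ht
  let μ := (volume : Measure ℝ).restrict (Set.Ioi 0)
  have hμ : ∀ᵐ x ∂μ, 0 < x := ae_restrict_mem measurableSet_Ioi
  let F : ℝ → ℝ → ℂ := fun b y =>
    ((b : ℂ) ^ (s - 1) * Complex.exp (-(y * b))) * ((y : ℂ) ^ (t - 1) * Complex.exp (-y))
  have hFm : AEStronglyMeasurable (Function.uncurry F) (μ.prod μ) := by
    apply Measurable.aestronglyMeasurable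
    simp only [F, Function.uncurry_def]
    fun_prop
  have hpow : ∀ y : ℝ, 0 < y → ∀ a : ℝ, (1 / y) ^ a = y ^ (-a) := by
    intro y hy a
    rw [one_div, Real.inv_rpow hy.le, Real.rpow_neg hy.le]
  have hpowC : ∀ y : ℝ, 0 < y → ∀ a : ℂ, (1 / (y : ℂ)) ^ a = (y : ℂ) ^ (-a) := by
    intro y hy a
    rw [one_div, Complex.inv_cpow, Complex.cpow_neg]
    rw [Complex.arg_ofReal_of_nonneg hy.le]
    exact Real.pi_pos.ne
  have hF : Integrable (Function.uncurry F) (μ.prod μ) := by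
    rw [integrable_prod_iff' hFm]
    constructor
    · filter_upwards [hμ] with y hy
      exact (gv_gammaInt hs hy).mul_const ((y : ℂ) ^ (t - 1) * Complex.exp (-y))
    · have h1 : IntegrableOn (fun y : ℝ => Real.Gamma s.re *
          (Real.exp (-y) * y ^ (t.re - s.re - 1))) (Set.Ioi 0) :=
        (Real.GammaIntegral_convergent (by linarith)).const_mul _
      refine Integrable.congr h1 ?_
      filter_upwards [hμ] with y hy
      have h2 : ∫ b, ‖Function.uncurry F (b, y)‖ ∂μ =
          ∫ b, (b ^ (s.re - 1) * Real.exp (-(y * b))) * (y ^ (t.re - 1) * Real.exp (-y)) ∂μ := by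
        apply integral_congr_ae
        filter_upwards [hμ] with b hb
        simp only [Function.uncurry_apply_pair, F, norm_mul,
          Complex.norm_cpow_eq_rpow_re_of_pos hb, Complex.norm_cpow_eq_rpow_re_of_pos hy,
          Complex.norm_exp]
        simp
      rw [h2, integral_mul_const, Real.integral_rpow_mul_exp_neg_mul_Ioi hs hy, hpow y hy,
        show t.re - s.re - 1 = -s.re + (t.re - 1) by ring, Real.rpow_add hy]
      ring
  have hin : ∀ b : ℝ, 0 < b → ∫ y, F b y ∂μ =
      Γ t * ((b : ℂ) ^ (s - 1) * ((1 + b : ℝ) : ℂ) ^ (-t)) := by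
    intro b hb
    have e : ∀ y : ℝ, F b y = (b : ℂ) ^ (s - 1) *
        ((y : ℂ) ^ (t - 1) * Complex.exp (-(((1 + b : ℝ) : ℂ) * y))) := by
      intro y
      simp only [F]
      rw [show -(((1 + b : ℝ) : ℂ) * y) = -(y * b) + -y by push_cast; ring, Complex.exp_add]
      ring
    simp_rw [e]
    rw [integral_const_mul, Complex.integral_cpow_mul_exp_neg_mul_Ioi ht (by linarith),
      hpowC _ (by linarith)]
    ring
  have hin2 : ∀ y : ℝ, 0 < y → ∫ b, F b y ∂μ =
      Γ s * ((y : ℂ) ^ (t - s - 1) * Complex.exp (-(((1 : ℝ) : ℂ) * y))) := by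
    intro y hy
    simp only [F]
    rw [integral_mul_const, Complex.integral_cpow_mul_exp_neg_mul_Ioi hs hy, hpowC _ hy,
      show t - s - 1 = -s + (t - 1) by ring, Complex.cpow_add _ _ (by exact_mod_cast hy.ne')]
    simp
    ring
  constructor
  · have h1 := (hF.integral_prod_left).const_mul (Γ t)⁻¹
    refine Integrable.congr h1 ?_
    filter_upwards [hμ] with b hb
    have := hin b hb
    simp only [Function.uncurry_apply_pair]
    rw [this]
    field_simp
  · have h1 := integral_integral_swap hF
    have h2 : ∫ b, ∫ y, F b y ∂μ ∂μ = Γ t * ∫ b, ((b : ℂ) ^ (s - 1) * ((1 + b : ℝ) : ℂ) ^ (-t)) ∂μ := by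
      rw [← integral_const_mul]
      apply integral_congr_ae
      filter_upwards [hμ] with b hb using hin b hb
    have h3 : ∫ y, ∫ b, F b y ∂μ ∂μ = Γ s * Γ (t - s) := by
      have h4 := Complex.integral_cpow_mul_exp_neg_mul_Ioi (a := t - s) (r := 1) (by simpa using hst)
        one_pos
      simp only [Complex.ofReal_one, div_one, Complex.one_cpow] at h4
      rw [one_mul] at h4
      rw [← h4, ← integral_const_mul]
      apply integral_congr_ae
      filter_upwards [hμ] with b hb
      rw [hin2 b hb]
      simp
    rw [h2, h3] at h1
    rw [← h1]
    field_simp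
    rfl

lemma gv_one {p t : ℂ} {ρ : ℝ} (hp : 0 < p.re) (hpt : p.re < t.re)
    (h1 : -p.re < ρ) (h2 : ρ < 0) {x : ℝ} (hx : 0 < x) :
    ∫ b in Set.Ioi (0 : ℝ), (b : ℂ) ^ (p - 1) * ((1 + b : ℝ) : ℂ) ^ (-t) *
        Complex.exp (-((x : ℂ) * b)) =
      (1 / (2 * (Real.pi : ℂ))) * ∫ u : ℝ, (x : ℂ) ^ ((ρ : ℂ) + u * Complex.I) *
        (Γ (-((ρ : ℂ) + u * Complex.I)) * Γ (t - p - ((ρ : ℂ) + u * Complex.I)) *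
          Γ (p + ((ρ : ℂ) + u * Complex.I)) / Γ t) := by
  let μ := (volume : Measure ℝ).restrict (Set.Ioi 0)
  have hμ : ∀ᵐ x ∂μ, 0 < x := ae_restrict_mem measurableSet_Ioi
  have hre : ∀ u : ℝ, ((ρ : ℂ) + u * Complex.I).re = ρ := by intro u; simp
  let F : ℝ → ℝ → ℂ := fun b u =>
    ((b : ℂ) ^ (p + ((ρ : ℂ) + u * Complex.I) - 1) * ((1 + b : ℝ) : ℂ) ^ (-t)) *
    (Γ (-((ρ : ℂ) + u * Complex.I)) * (x : ℂ) ^ ((ρ : ℂ) + u * Complex.I))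
  have hΓm : Measurable fun u : ℝ => Γ (-((ρ : ℂ) + u * Complex.I)) :=
    (gv_contGamma (by fun_prop) (by intro u; simpa using h2)).measurable
  have hF : Integrable (Function.uncurry F) (μ.prod volume) := by
    have hb := ((gv_beta (s := p + ρ) (t := t) (by simp; linarith) (by simp; linarith)).1).mul_prod
      ((gv_vertical_neg h2).const_mul ((x : ℂ) ^ (ρ : ℂ)))
    refine Integrable.mono hb ?_ ?_
    · apply Measurable.aestronglyMeasurable
      simp only [F, Function.uncurry_def]
      have : Measurable fun z : ℝ × ℝ => Γ (-((ρ : ℂ) + z.2 * Complex.I)) :=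
        hΓm.comp measurable_snd
      fun_prop
    · have := Measure.quasiMeasurePreserving_fst (μ := μ) (ν := (volume : Measure ℝ)) |>.ae hμ
      filter_upwards [this] with z hz
      simp only [F, Function.uncurry_def, norm_mul, Complex.norm_cpow_eq_rpow_re_of_pos hz,
        Complex.norm_cpow_eq_rpow_re_of_pos hx]
      apply le_of_eq
      simp only [Complex.sub_re, Complex.add_re, hre, Complex.ofReal_re]
      ring_nf
  have hs := integral_integral_swap hF
  have e1 : ∫ b, ∫ u, F b u ∂volume ∂μ = (2 * (Real.pi : ℂ)) *
      ∫ b, (b : ℂ) ^ (p - 1) * ((1 + b : ℝ) : ℂ) ^ (-t) * Complex.exp (-((x : ℂ) * b)) ∂μ := by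
    rw [← integral_const_mul]
    apply integral_congr_ae
    filter_upwards [hμ] with b hb
    have hE := gv_expMB h2 (mul_pos hx hb)
    rw [Complex.ofReal_mul] at hE
    rw [hE]
    have hπ : (Real.pi : ℂ) ≠ 0 := by exact_mod_cast Real.pi_ne_zero
    have e : ∀ u : ℝ, F b u = ((b : ℂ) ^ (p - 1) * ((1 + b : ℝ) : ℂ) ^ (-t)) *
        (Γ (-((ρ : ℂ) + u * Complex.I)) * ((x : ℂ) * b) ^ ((ρ : ℂ) + u * Complex.I)) := by
      intro u
      simp only [F]
      rw [Complex.mul_cpow_ofReal_nonneg hx.le hb.le,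
        show p + ((ρ : ℂ) + u * Complex.I) - 1 = (p - 1) + ((ρ : ℂ) + u * Complex.I) by ring,
        Complex.cpow_add _ _ (by exact_mod_cast hb.ne')]
      ring
    simp_rw [e]
    rw [integral_const_mul]
    generalize (∫ u : ℝ, Γ (-((ρ : ℂ) + u * Complex.I)) *
      ((x : ℂ) * b) ^ ((ρ : ℂ) + u * Complex.I)) = J
    field_simp
  have e2 : ∫ u, ∫ b, F b u ∂μ ∂volume = ∫ u : ℝ, (x : ℂ) ^ ((ρ : ℂ) + u * Complex.I) *
        (Γ (-((ρ : ℂ) + u * Complex.I)) * Γ (t - p - ((ρ : ℂ) + u * Complex.I)) *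
          Γ (p + ((ρ : ℂ) + u * Complex.I)) / Γ t) := by
    congr 1
    ext u
    simp only [F]
    rw [integral_mul_const, (gv_beta (s := p + ((ρ : ℂ) + u * Complex.I)) (t := t)
      (by rw [Complex.add_re, hre]; linarith) (by rw [Complex.add_re, hre]; linarith)).2, sub_add_eq_sub_sub]
    ring
  rw [e1, e2] at hs
  rw [← hs]
  have hπ : (Real.pi : ℂ) ≠ 0 := by exact_mod_cast Real.pi_ne_zero
  field_simp
  rfl

lemma gv_Kcont {p t : ℂ} {ρ : ℝ} (hpt : p.re < t.re)
    (h1 : -p.re < ρ) (h2 : ρ < 0) :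
    Continuous fun u : ℝ => Γ (-((ρ : ℂ) + u * Complex.I)) *
      Γ (t - p - ((ρ : ℂ) + u * Complex.I)) * Γ (p + ((ρ : ℂ) + u * Complex.I)) / Γ t := by
  refine Continuous.div_const (((gv_contGamma (by fun_prop) ?_).mul
    (gv_contGamma (by fun_prop) ?_)).mul (gv_contGamma (by fun_prop) ?_)) _ <;>
    (intro u; simp; linarith)

lemma gv_Kint {p t : ℂ} {ρ : ℝ} (hpt : p.re < t.re)
    (h1 : -p.re < ρ) (h2 : ρ < 0) :
    Integrable fun u : ℝ => Γ (-((ρ : ℂ) + u * Complex.I)) *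
      Γ (t - p - ((ρ : ℂ) + u * Complex.I)) * Γ (p + ((ρ : ℂ) + u * Complex.I)) / Γ t := by
  refine Integrable.mono' ((gv_vertical_neg h2).norm.mul_const
    (Real.Gamma (t.re - p.re - ρ) * Real.Gamma (p.re + ρ) / ‖Γ t‖))
    (gv_Kcont hpt h1 h2).aestronglyMeasurable (ae_of_all _ fun u => ?_)
  have a1 := gv_norm_Gamma_le (s := t - p - ((ρ : ℂ) + u * Complex.I)) (by simp; linarith)
  have a2 := gv_norm_Gamma_le (s := p + ((ρ : ℂ) + u * Complex.I)) (by simp; linarith)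
  have r1 : (t - p - ((ρ : ℂ) + u * Complex.I)).re = t.re - p.re - ρ := by simp
  have r2 : (p + ((ρ : ℂ) + u * Complex.I)).re = p.re + ρ := by simp
  rw [r1] at a1
  rw [r2] at a2
  rw [norm_div, norm_mul, norm_mul, mul_assoc, mul_div_assoc]
  have : 0 ≤ Real.Gamma (t.re - p.re - ρ) := (norm_nonneg _).trans a1
  gcongr

/-- Mellin–Barnes representation of the multivariate Beta-type integral produced by gluing
`r` diagrams at one bulk vertex (equating the paper's representations (C.8) and (C.9)).
Here `wₐ = ρₐ + i uₐ` runs along an upward-oriented vertical contour for each `a`. -/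
theorem glued_vertex_mellin_barnes
    (r : ℕ) (hr : 1 ≤ r) (A : ℂ) (p t : Fin r → ℂ) (ρ : Fin r → ℝ)
    (hA : 0 < A.re) (hp : ∀ a, 0 < (p a).re) (hpt : ∀ a, (p a).re < (t a).re)
    (hρ₁ : ∀ a, -(p a).re < ρ a) (hρ₂ : ∀ a, ρ a < 0)
    (hρ₃ : -A.re < ∑ a, ρ a) :
    Γ A *
      (∫ β in Set.univ.pi fun _ : Fin r => Set.Ioi (0 : ℝ),
        let S : ℝ := ∑ a, β a
        ((1 + S : ℝ) : ℂ) ^ (-A) *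
          ∏ a, ((β a : ℂ) ^ (p a - 1) * ((1 + β a : ℝ) : ℂ) ^ (-(t a)))) =
      (1 / (2 * (Real.pi : ℂ))) ^ r *
        (∫ u : Fin r → ℝ,
          Γ (A + ∑ a, ((ρ a : ℂ) + (u a : ℂ) * Complex.I)) *
            ∏ a, (Γ (-((ρ a : ℂ) + (u a : ℂ) * Complex.I)) *
              Γ (t a - p a - ((ρ a : ℂ) + (u a : ℂ) * Complex.I)) *
              Γ (p a + ((ρ a : ℂ) + (u a : ℂ) * Complex.I)) / Γ (t a))) := by
  let μ := (volume : Measure ℝ).restrict (Set.Ioi 0)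
  have hμ : ∀ᵐ x ∂μ, 0 < x := ae_restrict_mem measurableSet_Ioi
  let ν : Measure (Fin r → ℝ) := Measure.pi fun _ => μ
  have hν : (volume : Measure (Fin r → ℝ)).restrict (Set.univ.pi fun _ => Set.Ioi (0 : ℝ)) = ν := by
    rw [volume_pi]
    exact Measure.restrict_pi_pi _ _
  have hνpos : ∀ᵐ β ∂ν, ∀ a, 0 < β a := by
    rw [← hν]
    filter_upwards [ae_restrict_mem (MeasurableSet.univ_pi fun _ => measurableSet_Ioi)] with β hβ a
    exact hβ a (Set.mem_univ a)
  have hpowC : ∀ y : ℝ, 0 < y → ∀ a : ℂ, (1 / (y : ℂ)) ^ a = (y : ℂ) ^ (-a) := by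
    intro y hy a
    rw [one_div, Complex.inv_cpow, Complex.cpow_neg]
    rw [Complex.arg_ofReal_of_nonneg hy.le]
    exact Real.pi_pos.ne
  -- the one-dimensional kernels
  let K : Fin r → ℝ → ℂ := fun a u => Γ (-((ρ a : ℂ) + u * Complex.I)) *
      Γ (t a - p a - ((ρ a : ℂ) + u * Complex.I)) * Γ (p a + ((ρ a : ℂ) + u * Complex.I)) / Γ (t a)
  let B : Fin r → ℝ → ℂ := fun a b => (b : ℂ) ^ (p a - 1) * ((1 + b : ℝ) : ℂ) ^ (-(t a))
  have hKc : ∀ a, Continuous (K a) := fun a => gv_Kcont (hpt a) (hρ₁ a) (hρ₂ a)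
  have hKi : ∀ a, Integrable (K a) := fun a => gv_Kint (hpt a) (hρ₁ a) (hρ₂ a)
  have hBi : ∀ a, Integrable (B a) μ := fun a => (gv_beta (hp a) (hpt a)).1
  have hBm : ∀ a, Measurable (B a) := fun a => by simp only [B]; fun_prop
  have hπ : (Real.pi : ℂ) ≠ 0 := by exact_mod_cast Real.pi_ne_zero
  -- left-hand side
  let L : (Fin r → ℝ) → ℝ → ℂ := fun β x =>
    ((x : ℂ) ^ (A - 1) * Complex.exp (-x)) * ∏ a, (B a (β a) * Complex.exp (-((x : ℂ) * β a)))
  have hLi : Integrable (Function.uncurry L) (ν.prod μ) := by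
    have hb := (Integrable.fintype_prod (μ := fun _ : Fin r => μ) hBi).mul_prod
      (gv_gammaInt hA one_pos)
    refine Integrable.mono hb ?_ ?_
    · apply Measurable.aestronglyMeasurable
      simp only [L, Function.uncurry_def]
      fun_prop
    · filter_upwards [Measure.quasiMeasurePreserving_fst (μ := ν) (ν := μ) |>.ae hνpos,
        Measure.quasiMeasurePreserving_snd (μ := ν) (ν := μ) |>.ae hμ] with z hz1 hz2
      simp only [L, Function.uncurry_def, Finset.prod_mul_distrib, norm_mul]
      have : ‖∏ a, Complex.exp (-((z.2 : ℂ) * z.1 a))‖ ≤ 1 := by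
        rw [norm_prod]
        refine Finset.prod_le_one (fun _ _ => norm_nonneg _) fun a _ => ?_
        rw [Complex.norm_exp]
        have h0 : 0 ≤ z.2 * z.1 a := mul_nonneg (le_of_lt hz2) (le_of_lt (hz1 a))
        simpa using h0
      simp only [Complex.ofReal_one, one_mul]
      have hgen : ∀ c d e : ℝ, 0 ≤ c → 0 ≤ d → e ≤ 1 → c * (d * e) ≤ d * c := by
        intro c d e hc hd he
        rw [mul_comm d c]
        exact mul_le_mul_of_nonneg_left (mul_le_of_le_one_right hd he) hc
      exact hgen _ _ _ (mul_nonneg (norm_nonneg _) (norm_nonneg _)) (norm_nonneg _) this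
  have hLs := integral_integral_swap hLi
  have hL1 : ∫ β, ∫ x, L β x ∂μ ∂ν = Γ A * ∫ β, ((1 + ∑ a, β a : ℝ) : ℂ) ^ (-A) *
      ∏ a, B a (β a) ∂ν := by
    rw [← integral_const_mul]
    apply integral_congr_ae
    filter_upwards [hνpos] with β hβ
    have hS : 0 < 1 + ∑ a, β a := by
      have : 0 ≤ ∑ a, β a := Finset.sum_nonneg fun a _ => (hβ a).le
      linarith
    have e : ∀ x : ℝ, L β x = (∏ a, B a (β a)) *
        ((x : ℂ) ^ (A - 1) * Complex.exp (-(((1 + ∑ a, β a : ℝ) : ℂ) * x))) := by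
      intro x
      simp only [L, Finset.prod_mul_distrib]
      rw [← Complex.exp_sum]
      rw [show -(((1 + ∑ a, β a : ℝ) : ℂ) * x) = -x + ∑ a, -((x : ℂ) * β a) by
        push_cast
        rw [Finset.sum_neg_distrib, ← Finset.mul_sum]; ring, Complex.exp_add]
      ring
    simp_rw [e]
    rw [integral_const_mul, Complex.integral_cpow_mul_exp_neg_mul_Ioi hA hS, hpowC _ hS]
    ring
  have hL2 : ∫ x, ∫ β, L β x ∂ν ∂μ = ∫ x, ((x : ℂ) ^ (A - 1) * Complex.exp (-x)) *
      ∏ a, ∫ b, B a b * Complex.exp (-((x : ℂ) * b)) ∂μ ∂μ := by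
    congr 1
    ext x
    simp only [L]
    rw [integral_const_mul]
    congr 1
    exact integral_fintype_prod_eq_prod (μ := fun _ : Fin r => μ)
      (fun a (b : ℝ) => B a b * Complex.exp (-((x : ℂ) * b)))
  -- right-hand side
  let R : (Fin r → ℝ) → ℝ → ℂ := fun u x =>
    ((x : ℂ) ^ (A - 1) * Complex.exp (-x)) *
      ∏ a, ((x : ℂ) ^ ((ρ a : ℂ) + u a * Complex.I) * K a (u a))
  have hre : ∀ u : Fin r → ℝ, (A + ∑ a, ((ρ a : ℂ) + (u a : ℂ) * Complex.I)).re =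
      A.re + ∑ a, ρ a := by
    intro u
    simp
  have hRe : ∀ u : Fin r → ℝ, ∀ x : ℝ, 0 < x → R u x = (∏ a, K a (u a)) *
      ((x : ℂ) ^ (A + ∑ a, ((ρ a : ℂ) + (u a : ℂ) * Complex.I) - 1) *
        Complex.exp (-(((1 : ℝ) : ℂ) * x))) := by
    intro u x hx
    have hx0 : (x : ℂ) ≠ 0 := by exact_mod_cast hx.ne'
    have hsum : (x : ℂ) ^ (∑ a, ((ρ a : ℂ) + (u a : ℂ) * Complex.I)) =
        ∏ a, (x : ℂ) ^ ((ρ a : ℂ) + (u a : ℂ) * Complex.I) := by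
      simp only [Complex.cpow_def_of_ne_zero hx0, Finset.mul_sum, Complex.exp_sum]
    simp only [R, Finset.prod_mul_distrib]
    rw [show A + ∑ a, ((ρ a : ℂ) + (u a : ℂ) * Complex.I) - 1 =
      (A - 1) + ∑ a, ((ρ a : ℂ) + (u a : ℂ) * Complex.I) by ring, Complex.cpow_add _ _ hx0, hsum]
    simp only [Complex.ofReal_one, one_mul]
    ring
  have hRi : Integrable (Function.uncurry R) ((volume : Measure (Fin r → ℝ)).prod μ) := by
    have hb := (Integrable.fintype_prod (μ := fun _ : Fin r => (volume : Measure ℝ)) hKi).mul_prod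
      (gv_gammaInt (s := A + ∑ a, (ρ a : ℂ)) (by simp; linarith) one_pos)
    rw [← volume_pi] at hb
    refine Integrable.mono hb ?_ ?_
    · apply Measurable.aestronglyMeasurable
      simp only [R, Function.uncurry_def]
      have hKm : ∀ a, Measurable (K a) := fun a => (hKc a).measurable
      fun_prop
    · filter_upwards [Measure.quasiMeasurePreserving_snd
        (μ := (volume : Measure (Fin r → ℝ))) (ν := μ) |>.ae hμ] with z hz
      apply le_of_eq
      simp only [Function.uncurry_def]
      rw [hRe _ _ hz]
      simp only [norm_mul, Complex.norm_cpow_eq_rpow_re_of_pos hz]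
      rw [Complex.sub_re, hre]
      simp
  have hRs := integral_integral_swap hRi
  have hR1 : ∫ u, ∫ x, R u x ∂μ = ∫ u : Fin r → ℝ,
      Γ (A + ∑ a, ((ρ a : ℂ) + (u a : ℂ) * Complex.I)) * ∏ a, K a (u a) := by
    congr 1
    ext u
    have : ∫ x, R u x ∂μ = ∫ x, (∏ a, K a (u a)) *
      ((x : ℂ) ^ (A + ∑ a, ((ρ a : ℂ) + (u a : ℂ) * Complex.I) - 1) *
        Complex.exp (-(((1 : ℝ) : ℂ) * x))) ∂μ := by
      apply integral_congr_ae
      filter_upwards [hμ] with x hx using hRe u x hx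
    rw [this, integral_const_mul, Complex.integral_cpow_mul_exp_neg_mul_Ioi
      (by rw [hre]; linarith) one_pos]
    simp only [Complex.ofReal_one, div_one, Complex.one_cpow, one_mul]
    ring
  have hR2 : ∫ x, ∫ u, R u x ∂volume ∂μ = ∫ x, ((x : ℂ) ^ (A - 1) * Complex.exp (-x)) *
      ∏ a, ∫ u : ℝ, (x : ℂ) ^ ((ρ a : ℂ) + u * Complex.I) * K a u ∂volume ∂μ := by
    congr 1
    ext x
    simp only [R]
    rw [integral_const_mul]
    congr 1
    exact integral_fintype_prod_volume_eq_prod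
      (fun a (u : ℝ) => (x : ℂ) ^ ((ρ a : ℂ) + u * Complex.I) * K a u)
  -- conclusion
  rw [hν]
  refine hL1.symm.trans ?_
  refine Eq.trans ?_ (congrArg (fun z => (1 / (2 * (Real.pi : ℂ))) ^ r * z) hR1)
  rw [hLs, hRs, hL2, hR2, ← integral_const_mul]
  apply integral_congr_ae
  filter_upwards [hμ] with x hx
  have : ∀ a, ∫ b, B a b * Complex.exp (-((x : ℂ) * b)) ∂μ = (1 / (2 * (Real.pi : ℂ))) *
      ∫ u : ℝ, (x : ℂ) ^ ((ρ a : ℂ) + u * Complex.I) * K a u := fun a =>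
    gv_one (hp a) (hpt a) (hρ₁ a) (hρ₂ a) hx
  simp_rw [this]
  rw [Finset.prod_mul_distrib, Finset.prod_const, Finset.card_univ, Fintype.card_fin]
  ring
end
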